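/- arXiv:2211.07691 — 3 statements merged into one kernel-verified Lean document; each statement's English description precedes it below -/
import Mathlib

section
/- Let Q = Q_1⋯Q_t be a homogeneous polynomial in F[x_1,…,x_n] of degree d = d_1 + ⋯ + d_t ≥ 1, where each Q_i is homogeneous of degree d_i ≥ 1. Then for any integers 0 ≤ k < d and ℓ ≥ 0: SP_{k,ℓ}(Q) ≤ 2^t · d^2 · max{ M(n,k_0)·M(n,ℓ_0+ℓ) : k_0, ℓ_0 ≥ 0 integers with k_0 + (k/(d−k))·ℓ_0 ≤ k − residue_k(d_1,…,d_t) }. -/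
open MvPolynomial

/-- The iterated partial derivative operator `∂_m` associated to the exponent vector `m`. -/
noncomputable def iterDeriv {σv F : Type*} [CommRing F] (m : σv →₀ ℕ) :
    Module.End F (MvPolynomial σv F) :=
  (m.support.toList.map
    (fun i => ((MvPolynomial.pderiv i).toLinearMap : Module.End F (MvPolynomial σv F)) ^ m i)).prod

/-- `∂^k P` : the set of all partial derivatives of `P` of order `k`. -/
noncomputable def partialsSet {σv F : Type*} [CommRing F] (k : ℕ) (P : MvPolynomial σv F) :
    Set (MvPolynomial σv F) :=
  { g | ∃ m : σv →₀ ℕ, (m.sum fun _ e => e) = k ∧ g = iterDeriv m P }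

/-- `x^ℓ · ∂^k P` : degree-`ℓ` monomial multiples of order-`k` partial derivatives of `P`. -/
noncomputable def shiftedPartialsSet {σv F : Type*} [CommRing F] (ℓ k : ℕ)
    (P : MvPolynomial σv F) : Set (MvPolynomial σv F) :=
  { q | ∃ m : σv →₀ ℕ, (m.sum fun _ e => e) = ℓ ∧
      ∃ g ∈ partialsSet k P, q = MvPolynomial.monomial m (1 : F) * g }

/-- The shifted partials measure `SP_{k,ℓ}`. -/
noncomputable def SP {σv F : Type*} [Field F] (k ℓ : ℕ) (P : MvPolynomial σv F) : ℕ :=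
  Module.finrank F (Submodule.span F (shiftedPartialsSet ℓ k P))

/-- The affine projections of partials measure `APP_{k,n₀}`. -/
noncomputable def APP {σv F : Type*} [Field F] (k n0 : ℕ) (P : MvPolynomial σv F) : ℕ :=
  sSup { r : ℕ | ∃ L : σv → MvPolynomial (Fin n0) F, (∀ i, (L i).IsHomogeneous 1) ∧
    r = Module.finrank F (Submodule.span F
          ((fun g => MvPolynomial.aeval L g) '' partialsSet k P)) }

/-- `residue_k(d_1,…,d_t)`. -/
noncomputable def residue {t : ℕ} (k : ℕ) (ds : Fin t → ℕ) : ℝ :=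
  (1 / 2) * sInf { r : ℝ | ∃ κ : Fin t → ℤ,
    r = ∑ i, |(κ i : ℝ) - ((k : ℝ) / ((∑ i, ds i : ℕ) : ℝ)) * (ds i : ℝ)| }

/-- `M(a,b) = C(a+b−1, b)`, the number of monic monomials of degree `b` in `a` variables. -/
def M (a b : ℕ) : ℕ := Nat.choose (a + b - 1) b

open Finset

section CoeffProd

variable {σ R ι : Type*} [CommRing R]

/-- If a coefficient of a product of polynomials does not vanish, then its degree is a sum of
degrees of nonvanishing coefficients of the factors. -/
theorem exists_degree_of_coeff_prod_ne_zero [DecidableEq ι] (s : Finset ι)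
    (f : ι → MvPolynomial σ R) (p : ι → ℕ → Prop)
    (hf : ∀ i ∈ s, ∀ a, coeff a (f i) ≠ 0 → p i a.degree) (a : σ →₀ ℕ)
    (ha : coeff a (∏ i ∈ s, f i) ≠ 0) :
    ∃ κ : ι → ℕ, ∑ i ∈ s, κ i = a.degree ∧ ∀ i ∈ s, p i (κ i) := by
  classical
  induction s using Finset.induction_on generalizing a with
  | empty =>
    refine ⟨0, ?_, by simp⟩
    rw [prod_empty, coeff_one] at ha
    have : (0 : σ →₀ ℕ) = a := by by_contra h; simp [h] at ha
    simp [← this]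
  | insert i s his ih =>
    rw [prod_insert his, coeff_mul] at ha
    obtain ⟨⟨b, c⟩, hbc, hne⟩ := exists_ne_zero_of_sum_ne_zero ha
    obtain ⟨κ, hκ, hp⟩ := ih (fun j hj => hf j (mem_insert_of_mem hj)) c (right_ne_zero_of_mul hne)
    have hb := hf i (mem_insert_self i s) b (left_ne_zero_of_mul hne)
    have hne' : ∀ j ∈ s, j ≠ i := fun j hj h => his (h ▸ hj)
    refine ⟨Function.update κ i b.degree, ?_, ?_⟩
    · rw [sum_insert his, Function.update_self, sum_congr rfl
        (fun j hj => Function.update_of_ne (hne' j hj) _ _), hκ, ← mem_antidiagonal.mp hbc, map_add]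
    · intro j hj
      rcases mem_insert.mp hj with rfl | hj
      · simpa using hb
      · simpa [Function.update_of_ne (hne' j hj)] using hp j hj

/-- The part of a polynomial of degree at most `N`. -/
noncomputable def lowPart (N : ℕ) (f : MvPolynomial σ R) : MvPolynomial σ R :=
  ∑ j ∈ range (N + 1), homogeneousComponent j f

theorem coeff_lowPart (N : ℕ) (f : MvPolynomial σ R) (a : σ →₀ ℕ) :
    coeff a (lowPart N f) = if a.degree ≤ N then coeff a f else 0 := by
  simp [lowPart, coeff_sum, coeff_homogeneousComponent]

end CoeffProd

section Bihomogeneous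

variable {σ τ F : Type*} [CommRing F]

/-- A polynomial in `σ`-variables with coefficients polynomials in `τ`-variables is totally
homogeneous of degree `D` if it is so with respect to both sets of variables jointly. -/
def IsTotallyHomogeneous (f : MvPolynomial σ (MvPolynomial τ F)) (D : ℕ) : Prop :=
  ∀ a b, coeff b (coeff a f) ≠ 0 → a.degree + b.degree = D

namespace IsTotallyHomogeneous

variable {f g : MvPolynomial σ (MvPolynomial τ F)} {D E : ℕ}

theorem add (hf : IsTotallyHomogeneous f D) (hg : IsTotallyHomogeneous g D) :
    IsTotallyHomogeneous (f + g) D := by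
  intro a b h
  rw [coeff_add, coeff_add] at h
  by_cases h1 : coeff b (coeff a f) = 0
  · exact hg a b (by simpa [h1] using h)
  · exact hf a b h1

theorem neg (hf : IsTotallyHomogeneous f D) : IsTotallyHomogeneous (-f) D := by
  intro a b h
  exact hf a b (by simpa using h)

theorem sum {ι : Type*} (s : Finset ι) {f : ι → MvPolynomial σ (MvPolynomial τ F)}
    (hf : ∀ i ∈ s, IsTotallyHomogeneous (f i) D) : IsTotallyHomogeneous (∑ i ∈ s, f i) D := by
  intro a b h
  rw [coeff_sum, coeff_sum] at h
  obtain ⟨i, hi, hne⟩ := exists_ne_zero_of_sum_ne_zero h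
  exact hf i hi a b hne

theorem mul (hf : IsTotallyHomogeneous f D) (hg : IsTotallyHomogeneous g E) :
    IsTotallyHomogeneous (f * g) (D + E) := by
  classical
  intro a b h
  rw [coeff_mul, coeff_sum] at h
  obtain ⟨⟨a₁, a₂⟩, ha, hne⟩ := exists_ne_zero_of_sum_ne_zero h
  rw [coeff_mul] at hne
  obtain ⟨⟨b₁, b₂⟩, hb, hne⟩ := exists_ne_zero_of_sum_ne_zero hne
  rw [← hf a₁ b₁ (left_ne_zero_of_mul hne), ← hg a₂ b₂ (right_ne_zero_of_mul hne),
    ← mem_antidiagonal.mp ha, ← mem_antidiagonal.mp hb, map_add, map_add]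
  ring

theorem C_C (c : F) :
    IsTotallyHomogeneous (C (C c) : MvPolynomial σ (MvPolynomial τ F)) 0 := by
  classical
  intro a b h
  rw [coeff_C] at h
  split_ifs at h with ha
  · rw [coeff_C] at h
    split_ifs at h with hb
    · simp [← ha, ← hb]
    · exact absurd rfl h
  · simp at h

theorem prod {ι : Type*} (s : Finset ι) {f : ι → MvPolynomial σ (MvPolynomial τ F)} {e : ι → ℕ}
    (hf : ∀ i ∈ s, IsTotallyHomogeneous (f i) (e i)) :
    IsTotallyHomogeneous (∏ i ∈ s, f i) (∑ i ∈ s, e i) := by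
  classical
  induction s using Finset.induction_on with
  | empty => simpa using C_C (σ := σ) (τ := τ) (1 : F)
  | insert i s his ih =>
    rw [prod_insert his, sum_insert his]
    exact (hf i (mem_insert_self i s)).mul (ih fun j hj => hf j (mem_insert_of_mem hj))

theorem pow (hf : IsTotallyHomogeneous f D) (e : ℕ) : IsTotallyHomogeneous (f ^ e) (e * D) := by
  simpa using prod (range e) (fun _ _ => hf)

theorem lowPart (hf : IsTotallyHomogeneous f D) (N : ℕ) :
    IsTotallyHomogeneous (lowPart N f) D := by
  intro a b h
  rw [coeff_lowPart] at h
  split_ifs at h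
  · exact hf a b h
  · simp at h

theorem isHomogeneous_coeff (hf : IsTotallyHomogeneous f D) (a : σ →₀ ℕ) :
    (coeff a f).IsHomogeneous (D - a.degree) := by
  intro b hb
  have := hf a b hb
  rw [Pi.one_def, ← Finsupp.degree_eq_weight_one]
  omega

theorem degree_le (hf : IsTotallyHomogeneous f D) {a : σ →₀ ℕ} (ha : coeff a f ≠ 0) :
    a.degree ≤ D := by
  obtain ⟨b, hb⟩ := exists_coeff_ne_zero ha
  have := hf a b hb
  omega

theorem X_add_C_X (i : σ) :
    IsTotallyHomogeneous (X i + C (X i) : MvPolynomial σ (MvPolynomial σ F)) 1 := by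
  classical
  refine add ?_ ?_
  · intro a b h
    rw [coeff_X] at h
    split_ifs at h with ha
    · rw [coeff_one] at h
      split_ifs at h with hb
      · simp [← ha, ← hb]
      · exact absurd rfl h
    · simp at h
  · intro a b h
    rw [coeff_C] at h
    split_ifs at h with ha
    · rw [coeff_X] at h
      split_ifs at h with hb
      · simp [← ha, ← hb]
      · exact absurd rfl h
    · simp at h

end IsTotallyHomogeneous

end Bihomogeneous

section Taylor

variable {σ F : Type*} [CommRing F]

/-- The Taylor expansion `P(x + y)`, as a polynomial in `y` over the polynomials in `x`. -/
noncomputable def taylorExpand :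
    MvPolynomial σ F →ₐ[F] MvPolynomial σ (MvPolynomial σ F) :=
  aeval fun i => X i + C (X i)

theorem isTotallyHomogeneous_taylorExpand {P : MvPolynomial σ F} {D : ℕ}
    (hP : P.IsHomogeneous D) : IsTotallyHomogeneous (taylorExpand P) D := by
  rw [taylorExpand, aeval_def, eval₂_eq]
  refine IsTotallyHomogeneous.sum _ fun m hm => ?_
  have hm : m.degree = D := by
    have := hP (mem_support_iff.mp hm)
    rwa [Pi.one_def, ← Finsupp.degree_eq_weight_one] at this
  rw [← zero_add D, ← hm]
  refine (IsTotallyHomogeneous.C_C _).mul (IsTotallyHomogeneous.prod _ fun i _ => ?_)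
  simpa using (IsTotallyHomogeneous.X_add_C_X (F := F) i).pow (m i)

theorem coeff_zero_taylorExpand (P : MvPolynomial σ F) : coeff 0 (taylorExpand P) = P := by
  change constantCoeff (taylorExpand P) = P
  induction P using MvPolynomial.induction_on with
  | C c => simp [taylorExpand, IsScalarTower.algebraMap_apply F (MvPolynomial σ F)
      (MvPolynomial σ (MvPolynomial σ F)), MvPolynomial.algebraMap_eq]
  | add p q hp hq => simp [hp, hq]
  | mul_X p i hp => rw [map_mul, map_mul, hp]; simp [taylorExpand]

theorem taylorExpand_pderiv (i : σ) (P : MvPolynomial σ F) :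
    taylorExpand (pderiv i P) = pderiv i (taylorExpand P) := by
  classical
  induction P using MvPolynomial.induction_on with
  | C c => simp [taylorExpand, IsScalarTower.algebraMap_apply F (MvPolynomial σ F)
      (MvPolynomial σ (MvPolynomial σ F)), MvPolynomial.algebraMap_eq]
  | add p q hp hq => simp [hp, hq]
  | mul_X p j hp =>
    have hX : taylorExpand (pderiv i (X j : MvPolynomial σ F)) =
        pderiv i (taylorExpand (X j : MvPolynomial σ F)) := by
      by_cases h : j = i
      · subst h; simp [taylorExpand]
      · simp [taylorExpand, pderiv_X_of_ne h]
    rw [pderiv_mul, map_add, map_mul, map_mul, map_mul, pderiv_mul, hp, hX]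

theorem exists_coeff_taylorExpand_pderiv_pow (i : σ) (e : ℕ) (a : σ →₀ ℕ) :
    ∃ c : F, ∀ P : MvPolynomial σ F,
      coeff a (taylorExpand (((pderiv i).toLinearMap ^ e : Module.End F (MvPolynomial σ F)) P)) =
        c • coeff (a + Finsupp.single i e) (taylorExpand P) := by
  induction e generalizing a with
  | zero => exact ⟨1, fun P => by simp⟩
  | succ e ih =>
    obtain ⟨c, hc⟩ := ih (a + Finsupp.single i 1)
    refine ⟨((a i : F) + 1) * c, fun P => ?_⟩
    rw [pow_succ', Module.End.mul_apply]
    erw [taylorExpand_pderiv]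
    rw [coeff_pderiv, hc, add_assoc, ← Finsupp.single_add, add_comm 1 e, mul_smul,
      smul_comm, MvPolynomial.smul_eq_C_mul (_ : MvPolynomial σ F) ((a i : F) + 1)]
    simp [mul_comm]

/-- The iterated derivative `∂_m P` is a scalar multiple of the `m`-th Taylor coefficient. -/
theorem exists_iterDeriv_eq_smul_coeff (m : σ →₀ ℕ) :
    ∃ c : F, ∀ P : MvPolynomial σ F, iterDeriv m P = c • coeff m (taylorExpand P) := by
  have key : ∀ (l : List σ) (a : σ →₀ ℕ), ∃ c : F, ∀ P : MvPolynomial σ F,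
      coeff a (taylorExpand ((l.map (fun i =>
        ((pderiv i).toLinearMap : Module.End F (MvPolynomial σ F)) ^ m i)).prod P)) =
        c • coeff (a + (l.map fun i => Finsupp.single i (m i)).sum) (taylorExpand P) := by
    intro l
    induction l with
    | nil => exact fun a => ⟨1, fun P => by simp⟩
    | cons i l ih =>
      intro a
      obtain ⟨c₁, h₁⟩ := exists_coeff_taylorExpand_pderiv_pow (F := F) i (m i) a
      obtain ⟨c₂, h₂⟩ := ih (a + Finsupp.single i (m i))
      refine ⟨c₁ * c₂, fun P => ?_⟩
      rw [List.map_cons, List.prod_cons, Module.End.mul_apply, h₁, h₂, List.map_cons,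
        List.sum_cons, add_assoc, mul_smul]
  obtain ⟨c, hc⟩ := key m.support.toList 0
  refine ⟨c, fun P => ?_⟩
  have hm : (m.support.toList.map fun i => Finsupp.single i (m i)).sum = m := by
    rw [Finset.sum_map_toList]
    exact m.sum_single
  rw [← coeff_zero_taylorExpand (iterDeriv m P), iterDeriv, hc, zero_add, hm]

end Taylor

section Residue

variable {t : ℕ}

theorem residue_le (k : ℕ) (ds : Fin t → ℕ) (κ : Fin t → ℤ) :
    residue k ds ≤
      (1 / 2) * ∑ i, |(κ i : ℝ) - ((k : ℝ) / ((∑ i, ds i : ℕ) : ℝ)) * (ds i : ℝ)| := by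
  refine mul_le_mul_of_nonneg_left (csInf_le ⟨0, ?_⟩ ⟨κ, rfl⟩) (by norm_num)
  rintro r ⟨κ', rfl⟩
  positivity

theorem residue_nonneg (k : ℕ) (ds : Fin t → ℕ) : 0 ≤ residue k ds := by
  refine mul_nonneg (by norm_num) (Real.sInf_nonneg ?_)
  rintro r ⟨κ, rfl⟩
  positivity

theorem residue_le_self (k : ℕ) (ds : Fin t → ℕ) (hd : 0 < ∑ i, ds i) :
    residue k ds ≤ k := by
  have hd' : (0 : ℝ) < ((∑ i, ds i : ℕ) : ℝ) := by exact_mod_cast hd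
  have h := residue_le k ds 0
  have h' :
      ∑ i, |((0 : Fin t → ℤ) i : ℝ) - ((k : ℝ) / ((∑ i, ds i : ℕ) : ℝ)) * (ds i : ℝ)| = k := by
    have : ∀ i, |((0 : Fin t → ℤ) i : ℝ) - ((k : ℝ) / ((∑ i, ds i : ℕ) : ℝ)) * (ds i : ℝ)| =
        ((k : ℝ) / ((∑ i, ds i : ℕ) : ℝ)) * (ds i : ℝ) := by
      intro i
      rw [Pi.zero_apply, Int.cast_zero, zero_sub, abs_neg, abs_of_nonneg (by positivity)]
    rw [sum_congr rfl fun i _ => this i, ← mul_sum, ← Nat.cast_sum]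
    field_simp
  rw [h'] at h
  have : (0 : ℝ) ≤ k := by positivity
  linarith

/-- If `κ` distributes `k` so that the entries outside `H` are at most their proportional share and
those in `H` at least their proportional share, then the excess over `H` is at least the residue. -/
theorem residue_le_excess (k : ℕ) (ds κ : Fin t → ℕ) (hd : 0 < ∑ i, ds i) (H : Finset (Fin t))
    (hsum : ∑ i, κ i = k) (hH : ∀ i ∈ H, k * ds i ≤ (∑ i, ds i) * κ i)
    (hHc : ∀ i ∉ H, (∑ i, ds i) * κ i ≤ k * ds i) :
    ((∑ i, ds i : ℕ) : ℝ) * residue k ds ≤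
      ((∑ i, ds i : ℕ) : ℝ) * ((∑ i ∈ H, κ i : ℕ) : ℝ) - k * ((∑ i ∈ H, ds i : ℕ) : ℝ) := by
  have hres := residue_le k ds fun i => (κ i : ℤ)
  set d := ∑ i, ds i with hdd
  have hd' : (0 : ℝ) < (d : ℝ) := by exact_mod_cast hd
  have hin : ∀ i ∈ H, |(((κ i : ℤ) : ℝ)) - (k : ℝ) / d * ds i| = (κ i : ℝ) - (k : ℝ) / d * ds i := by
    intro i hi
    have h : (k : ℝ) * ds i ≤ d * κ i := by exact_mod_cast hH i hi
    rw [abs_of_nonneg]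
    · simp
    · rw [sub_nonneg, div_mul_eq_mul_div, div_le_iff₀ hd', Int.cast_natCast]
      linarith
  have hout : ∀ i ∈ Hᶜ,
      |(((κ i : ℤ) : ℝ)) - (k : ℝ) / d * ds i| = -((κ i : ℝ) - (k : ℝ) / d * ds i) := by
    intro i hi
    have h : (d : ℝ) * κ i ≤ k * ds i := by exact_mod_cast hHc i (by simpa using hi)
    rw [abs_of_nonpos]
    · simp
    · rw [sub_nonpos, div_mul_eq_mul_div, le_div_iff₀ hd', Int.cast_natCast]
      linarith
  have hzero : ∑ i, ((κ i : ℝ) - (k : ℝ) / d * ds i) = 0 := by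
    rw [sum_sub_distrib, ← mul_sum, ← Nat.cast_sum, ← Nat.cast_sum, hsum, ← hdd]
    field_simp
    ring
  rw [← sum_add_sum_compl H, sum_congr rfl hin, sum_congr rfl hout, sum_neg_distrib] at hres
  rw [← sum_add_sum_compl H] at hzero
  have h : residue k ds ≤ ∑ i ∈ H, ((κ i : ℝ) - (k : ℝ) / d * ds i) := by linarith
  calc (d : ℝ) * residue k ds ≤ d * ∑ i ∈ H, ((κ i : ℝ) - (k : ℝ) / d * ds i) := by gcongr
    _ = _ := by
      rw [sum_sub_distrib, ← mul_sum, Nat.cast_sum H κ, Nat.cast_sum H ds, mul_sub, ← mul_assoc,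
        mul_div_cancel₀ _ hd'.ne']

end Residue

section Decomposition

variable {F : Type*} [Field F] {n t : ℕ}

/-- The shifted Taylor coefficients of `∏ i, Q i` of order `k` lie in any subspace containing the
products of forms of degree `ℓ₀ + ℓ` with Taylor coefficients of order `k₀` of the partial products
`∏ i ∈ S, Q i`, where `(k₀, ℓ₀)` satisfies the residue bound. -/
theorem mul_coeff_taylorExpand_prod_mem
    (Q : Fin t → MvPolynomial (Fin n) F) (ds : Fin t → ℕ)
    (hhom : ∀ i, (Q i).IsHomogeneous (ds i)) (k ℓ : ℕ) (hk : k < ∑ i, ds i)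
    (W : Submodule F (MvPolynomial (Fin n) F))
    (hW : ∀ (S : Finset (Fin t)) (k₀ ℓ₀ : ℕ), k₀ ≤ k → ℓ₀ + (k - k₀) = ∑ i ∈ Sᶜ, ds i →
      (k₀ : ℝ) + ((k : ℝ) / (((∑ i, ds i : ℕ) : ℝ) - (k : ℝ))) * (ℓ₀ : ℝ) ≤
        (k : ℝ) - residue k ds →
      ∀ p : MvPolynomial (Fin n) F, p.IsHomogeneous (ℓ₀ + ℓ) →
      ∀ b : Fin n →₀ ℕ, b.degree = k₀ → p * coeff b (taylorExpand (∏ i ∈ S, Q i)) ∈ W)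
    (q : MvPolynomial (Fin n) F) (hq : q.IsHomogeneous ℓ) (m : Fin n →₀ ℕ) (hm : m.degree = k) :
    q * coeff m (taylorExpand (∏ i, Q i)) ∈ W := by
  classical
  have hres0 := residue_nonneg k ds
  have hexc := residue_le_excess k ds
  set d := ∑ i, ds i with hdd
  have hd : 0 < d := by omega
  have hkd : (k : ℝ) < d := by exact_mod_cast hk
  set l : Fin t → MvPolynomial (Fin n) (MvPolynomial (Fin n) F) :=
    fun i => lowPart (k * ds i / d) (taylorExpand (Q i)) with hl
  set g : Fin t → MvPolynomial (Fin n) (MvPolynomial (Fin n) F) :=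
    fun i => l i + -taylorExpand (Q i) with hg
  have hT : ∀ i, IsTotallyHomogeneous (taylorExpand (Q i)) (ds i) :=
    fun i => isTotallyHomogeneous_taylorExpand (hhom i)
  have hgT : ∀ i, IsTotallyHomogeneous (g i) (ds i) := fun i => ((hT i).lowPart _).add (hT i).neg
  have hlow : ∀ i a, coeff a (l i) ≠ 0 → d * a.degree ≤ k * ds i := by
    intro i a h
    simp only [hl, coeff_lowPart] at h
    split_ifs at h with h'
    · rw [mul_comm]
      exact (Nat.le_div_iff_mul_le hd).mp h'
    · exact absurd rfl h
  have hhigh : ∀ i a, coeff a (g i) ≠ 0 → k * ds i ≤ d * a.degree := by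
    intro i a h
    simp only [hg, hl, coeff_add, coeff_neg, coeff_lowPart] at h
    split_ifs at h with h'
    · simp at h
    · rw [not_le, Nat.div_lt_iff_lt_mul hd, mul_comm a.degree] at h'
      exact h'.le
  have hexp : taylorExpand (∏ i, Q i) =
      ∑ U ∈ univ.powerset, (∏ i ∈ U, l i) * ∏ i ∈ univ \ U, -g i := by
    rw [map_prod, ← prod_add]
    exact prod_congr rfl fun i _ => by simp [hg]
  have hexpl : ∀ U : Finset (Fin t), ∏ i ∈ U, l i =
      ∑ S ∈ U.powerset, taylorExpand (∏ i ∈ S, Q i) * ∏ i ∈ U \ S, g i := by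
    intro U
    simp_rw [map_prod]
    rw [← prod_add]
    exact prod_congr rfl fun i _ => by simp [hg]
  rw [hexp, coeff_sum, mul_sum]
  refine sum_mem fun U _ => ?_
  rw [coeff_mul, mul_sum]
  refine sum_mem fun ba hba => ?_
  obtain ⟨b, a⟩ := ba
  have hba : b + a = m := by simpa using hba
  dsimp only
  by_cases hb0 : coeff b (∏ i ∈ U, l i) = 0
  · simp [hb0]
  by_cases ha0 : coeff a (∏ i ∈ univ \ U, -g i) = 0
  · simp [ha0]
  obtain ⟨κ₁, hκ₁, hκ₁'⟩ := exists_degree_of_coeff_prod_ne_zero U l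
    (fun i e => d * e ≤ k * ds i) (fun i _ => hlow i) b hb0
  obtain ⟨κ₂, hκ₂, hκ₂'⟩ := exists_degree_of_coeff_prod_ne_zero (univ \ U) (fun i => -g i)
    (fun i e => k * ds i ≤ d * e) (fun i _ e he => hhigh i e (by simpa using he)) a ha0
  have hT₂ : IsTotallyHomogeneous (∏ i ∈ univ \ U, -g i) (∑ i ∈ univ \ U, ds i) :=
    IsTotallyHomogeneous.prod _ fun i _ => (hgT i).neg
  have ha_le := hT₂.degree_le ha0
  have hdeg : b.degree + a.degree = k := by rw [← hm, ← hba, map_add]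
  have hexc' : (d : ℝ) * residue k ds ≤
      (d : ℝ) * (a.degree : ℝ) - k * ((∑ i ∈ univ \ U, ds i : ℕ) : ℝ) := by
    have hsum₂ : ∑ i ∈ univ \ U, (if i ∈ U then κ₁ i else κ₂ i) = a.degree := by
      rw [← hκ₂]
      exact sum_congr rfl fun i hi => if_neg (mem_sdiff.mp hi).2
    have hsum₁ : ∑ i ∈ U, (if i ∈ U then κ₁ i else κ₂ i) = b.degree := by
      rw [← hκ₁]
      exact sum_congr rfl fun i hi => if_pos hi
    have := hexc (fun i => if i ∈ U then κ₁ i else κ₂ i) hd (univ \ U) ?_ ?_ ?_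
    · rwa [hsum₂] at this
    · rw [← sum_sdiff (subset_univ U), hsum₁, hsum₂]
      omega
    · intro i hi
      rw [if_neg (mem_sdiff.mp hi).2]
      exact hκ₂' i hi
    · intro i hi
      have hi : i ∈ U := by simpa using hi
      rw [if_pos hi]
      exact hκ₁' i hi
  rw [hexpl U, coeff_sum, sum_mul, mul_sum]
  refine sum_mem fun S hS => ?_
  have hSU : S ⊆ U := mem_powerset.mp hS
  rw [coeff_mul, sum_mul, mul_sum]
  refine sum_mem fun ba₂ hba₂ => ?_
  obtain ⟨b', a'⟩ := ba₂
  have hba₂ : b' + a' = b := by simpa using hba₂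
  dsimp only
  by_cases ha'0 : coeff a' (∏ i ∈ U \ S, g i) = 0
  · simp [ha'0]
  obtain ⟨κ₃, hκ₃, hκ₃'⟩ := exists_degree_of_coeff_prod_ne_zero (U \ S) g
    (fun i e => k * ds i ≤ d * e) (fun i _ => hhigh i) a' ha'0
  have hT₃ : IsTotallyHomogeneous (∏ i ∈ U \ S, g i) (∑ i ∈ U \ S, ds i) :=
    IsTotallyHomogeneous.prod _ fun i _ => hgT i
  have ha'_le := hT₃.degree_le ha'0
  have hdeg' : b'.degree + a'.degree = b.degree := by rw [← hba₂, map_add]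
  have hexc₃ : k * ∑ i ∈ U \ S, ds i ≤ d * a'.degree := by
    rw [← hκ₃, mul_sum, mul_sum]
    exact sum_le_sum hκ₃'
  have hexc₃' : (k : ℝ) * ((∑ i ∈ U \ S, ds i : ℕ) : ℝ) ≤ d * a'.degree := by
    exact_mod_cast hexc₃
  have hcompl : ∑ i ∈ Sᶜ, ds i = ∑ i ∈ univ \ U, ds i + ∑ i ∈ U \ S, ds i := by
    rw [compl_eq_univ_sdiff, ← sum_union]
    · congr 1
      ext i
      simp only [mem_sdiff, mem_union, mem_univ, true_and]
      have := @hSU i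
      tauto
    · exact disjoint_left.mpr fun i hi hi' => (mem_sdiff.mp hi).2 (mem_sdiff.mp hi').1
  generalize ∑ i ∈ univ \ U, ds i = e₂ at *
  generalize ∑ i ∈ U \ S, ds i = e₃ at *
  have hmem := hW S b'.degree ((e₂ - a.degree) + (e₃ - a'.degree)) (by omega) (by omega) ?_
    (q * coeff a (∏ i ∈ univ \ U, -g i) * coeff a' (∏ i ∈ U \ S, g i)) ?_ b' rfl
  · convert hmem using 1
    ring
  · have hk0 : (b'.degree : ℝ) = k - a.degree - a'.degree := by
      rw [← hdeg, ← hdeg']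
      push_cast
      ring
    rw [hk0, Nat.cast_add, Nat.cast_sub ha_le, Nat.cast_sub ha'_le, div_mul_eq_mul_div,
      ← le_sub_iff_add_le', div_le_iff₀ (by linarith)]
    nlinarith [mul_nonneg (Nat.cast_nonneg (α := ℝ) k) hres0]
  · rw [add_comm _ ℓ, ← add_assoc]
    exact (hq.mul (hT₂.isHomogeneous_coeff a)).mul (hT₃.isHomogeneous_coeff a')

end Decomposition

section Counting

theorem card_finsuppAntidiag_univ_fin (n b : ℕ) :
    #(finsuppAntidiag (univ : Finset (Fin n)) b) = M n b := by
  rw [card_finsuppAntidiag_nat_eq_choose]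
  simp [M]

theorem mem_finsuppAntidiag_univ_iff {n b : ℕ} {a : Fin n →₀ ℕ} :
    a ∈ finsuppAntidiag (univ : Finset (Fin n)) b ↔ a.degree = b := by
  simp [Finsupp.degree_eq_sum]

variable {F : Type*} [Field F] {n : ℕ}

/-- The degree-`L` monomial multiples of the Taylor coefficients of `P` of order `b`. -/
noncomputable def taylorShifts (L b : ℕ) (P : MvPolynomial (Fin n) F) :
    Set (MvPolynomial (Fin n) F) :=
  (fun ab : (Fin n →₀ ℕ) × (Fin n →₀ ℕ) => monomial ab.1 1 * coeff ab.2 (taylorExpand P)) ''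
    ↑(finsuppAntidiag (univ : Finset (Fin n)) L ×ˢ finsuppAntidiag (univ : Finset (Fin n)) b)

theorem finite_taylorShifts (L b : ℕ) (P : MvPolynomial (Fin n) F) :
    (taylorShifts L b P).Finite :=
  (finite_toSet _).image _

theorem ncard_taylorShifts_le (L b : ℕ) (P : MvPolynomial (Fin n) F) :
    (taylorShifts L b P).ncard ≤ M n b * M n L := by
  refine (Set.ncard_image_le (finite_toSet _)).trans_eq ?_
  rw [Set.ncard_coe_finset, card_product, card_finsuppAntidiag_univ_fin,
    card_finsuppAntidiag_univ_fin, mul_comm]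

theorem mul_coeff_mem_span_taylorShifts {L b : ℕ} (P p : MvPolynomial (Fin n) F)
    (hp : p.IsHomogeneous L) (a : Fin n →₀ ℕ) (ha : a.degree = b) :
    p * coeff a (taylorExpand P) ∈ Submodule.span F (taylorShifts L b P) := by
  rw [p.as_sum, sum_mul]
  refine sum_mem fun v hv => ?_
  have hv : v.degree = L := by
    have := hp (mem_support_iff.mp hv)
    rwa [Pi.one_def, ← Finsupp.degree_eq_weight_one] at this
  rw [← mul_one (coeff v p), ← smul_eq_mul (coeff v p), ← smul_monomial, smul_mul_assoc]
  refine Submodule.smul_mem _ _ (Submodule.subset_span ⟨(v, a), ?_, rfl⟩)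
  rw [coe_product]
  exact ⟨mem_finsuppAntidiag_univ_iff.mpr hv, mem_finsuppAntidiag_univ_iff.mpr ha⟩

end Counting

/-- upper bound on the shifted partials of a product. -/
theorem stmt1 {F : Type*} [Field F] {n t : ℕ} (hn : 0 < n) (ht : 0 < t)
    (Q : Fin t → MvPolynomial (Fin n) F) (ds : Fin t → ℕ)
    (hhom : ∀ i, (Q i).IsHomogeneous (ds i)) (hpos : ∀ i, 1 ≤ ds i)
    (d : ℕ) (hd : d = ∑ i, ds i) (hd1 : 1 ≤ d)
    (k ℓ : ℕ) (hk : k < d) :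
    ∃ k0 ℓ0 : ℕ,
      (k0 : ℝ) + ((k : ℝ) / ((d : ℝ) - (k : ℝ))) * (ℓ0 : ℝ) ≤ (k : ℝ) - residue k ds ∧
      SP k ℓ (∏ i, Q i) ≤ 2 ^ t * d ^ 2 * (M n k0 * M n (ℓ0 + ℓ)) := by
  classical
  subst hd
  let good : ℕ × ℕ → Prop := fun e =>
    (e.1 : ℝ) + ((k : ℝ) / (((∑ i, ds i : ℕ) : ℝ) - (k : ℝ))) * (e.2 : ℝ) ≤ (k : ℝ) - residue k ds
  let pr : Finset (Fin t) × ℕ → ℕ × ℕ := fun Sk => (Sk.2, ∑ i ∈ Sk.1ᶜ, ds i - (k - Sk.2))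
  let I := ((univ : Finset (Finset (Fin t))) ×ˢ range (k + 1)).filter fun Sk => good (pr Sk)
  have hI : #I ≤ 2 ^ t * (∑ i, ds i) ^ 2 := by
    refine (card_filter_le _ _).trans ?_
    rw [card_product, card_univ, Fintype.card_finset, Fintype.card_fin, card_range]
    refine Nat.mul_le_mul_left _ ?_
    nlinarith
  obtain ⟨e, he, hmax⟩ := exists_max_image (insert (0, 0) (I.image pr))
    (fun e => M n e.1 * M n (e.2 + ℓ)) (insert_nonempty _ _)
  refine ⟨e.1, e.2, ?_, ?_⟩
  · rcases mem_insert.mp he with rfl | he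
    · simpa using residue_le_self k ds (by omega)
    · obtain ⟨Sk, hSk, rfl⟩ := mem_image.mp he
      exact (mem_filter.mp hSk).2
  let Z : Set (MvPolynomial (Fin n) F) :=
    ⋃ Sk ∈ I, taylorShifts ((pr Sk).2 + ℓ) Sk.2 (∏ i ∈ Sk.1, Q i)
  have hZfin : Z.Finite := I.finite_toSet.biUnion fun _ _ => finite_taylorShifts _ _ _
  have hZcard : Z.ncard ≤ #I * (M n e.1 * M n (e.2 + ℓ)) := by
    refine (Finset.set_ncard_biUnion_le I _).trans ?_
    rw [← smul_eq_mul]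
    refine sum_le_card_nsmul _ _ _ fun Sk hSk => ?_
    exact (ncard_taylorShifts_le _ _ _).trans
      (hmax (pr Sk) (mem_insert_of_mem (mem_image_of_mem _ hSk)))
  have hsub : Submodule.span F (shiftedPartialsSet ℓ k (∏ i, Q i)) ≤ Submodule.span F Z := by
    rw [Submodule.span_le]
    rintro _ ⟨c, hc, _, ⟨m, hm, rfl⟩, rfl⟩
    obtain ⟨r, hr⟩ := exists_iterDeriv_eq_smul_coeff (F := F) m
    rw [hr, mul_smul_comm]
    refine Submodule.smul_mem _ _ (mul_coeff_taylorExpand_prod_mem Q ds hhom k ℓ hk _ ?_ _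
      (isHomogeneous_monomial 1 hc) m hm)
    intro S k₀ ℓ₀ hk₀ hℓ₀ hgood p hp b hb
    have hpr : pr (S, k₀) = (k₀, ℓ₀) := by
      simp only [pr, ← hℓ₀, Nat.add_sub_cancel]
    have hSk : (S, k₀) ∈ I := by
      refine mem_filter.mpr ⟨by simp; omega, ?_⟩
      rw [hpr]
      exact hgood
    refine Submodule.span_mono ?_ (mul_coeff_mem_span_taylorShifts _ p hp b hb)
    refine Set.subset_biUnion_of_mem
      (u := fun Sk => taylorShifts ((pr Sk).2 + ℓ) Sk.2 (∏ i ∈ Sk.1, Q i)) hSk |>.trans' ?_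
    rw [hpr]
  have : Module.Finite F (Submodule.span F Z) := Module.Finite.span_of_finite F hZfin
  calc SP k ℓ (∏ i, Q i) ≤ Module.finrank F (Submodule.span F Z) := Submodule.finrank_mono hsub
    _ ≤ Z.ncard := by
      have := hZfin.fintype
      rw [Set.ncard_eq_toFinset_card']
      exact finrank_span_le_card Z
    _ ≤ _ := hZcard
    _ ≤ _ := Nat.mul_le_mul_right _ hI
end

section
/- There exist absolute constants c_2, c_3 > 0 such that for every real c_1 ≥ 0 the following holds. Let F be a field and let P = Σ_{i=1}^s Q_{i,1}⋯Q_{i,t_i} be a homogeneous polynomial of degree d ≥ 1 in F[x_1,…,x_n], where each Q_{i,j} is homogeneous and nonconstant. Let k be an integer with 1 ≤ k < d/2, let n_0 be an integer with d ≤ n_0 ≤ n and (d−k)·(n/k)^{k/(d−k)} ≤ n_0 ≤ 2(d−k)·(n/k)^{k/(d−k)}, and let ℓ = ⌊n·d/n_0⌋. Suppose SP_{k,ℓ}(P) ≥ 2^{−c_1·d}·M(n,k)·M(n,ℓ), and suppose there exists γ > 0 such that residue_k(deg Q_{i,1}, …, deg Q_{i,t_i}) ≥ γ for every i ∈ [s].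 Then s ≥ 2^{−(c_1+c_2)·d}·(n/d)^{c_3·γ}. -/
open MvPolynomial

/-- The Taylor expansion `P(x + y)`, as a polynomial in `y` whose coefficients are polynomials
in `x`. Its coefficients are the Hasse derivatives of `P`. -/
noncomputable def taylorExpansion {σv F : Type*} [CommRing F] :
    MvPolynomial σv F →ₐ[F] MvPolynomial σv (MvPolynomial σv F) :=
  aeval fun i => X i + C (X i)

/-- A polynomial in `y` over polynomials in `x` is homogeneous of total degree `e` if all its
monomials have joint degree `e` in `x` and `y`. -/
def IsTotalHomogeneous {σv F : Type*} [CommRing F] (G : MvPolynomial σv (MvPolynomial σv F))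
    (e : ℕ) : Prop :=
  ∀ m a, coeff a (coeff m G) ≠ 0 → m.degree + a.degree = e

section Taylor

variable {σv F : Type*} [CommRing F]

theorem IsTotalHomogeneous.mul {G H : MvPolynomial σv (MvPolynomial σv F)} {e f : ℕ}
    (hG : IsTotalHomogeneous G e) (hH : IsTotalHomogeneous H f) :
    IsTotalHomogeneous (G * H) (e + f) := by
  classical
  intro m a h
  rw [coeff_mul, coeff_sum] at h
  obtain ⟨p, hp, h⟩ := Finset.exists_ne_zero_of_sum_ne_zero h
  rw [coeff_mul] at h
  obtain ⟨q, hq, h⟩ := Finset.exists_ne_zero_of_sum_ne_zero h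
  have h1 := hG _ _ (left_ne_zero_of_mul h)
  have h2 := hH _ _ (right_ne_zero_of_mul h)
  rw [← Finset.HasAntidiagonal.mem_antidiagonal.1 hp,
    ← Finset.HasAntidiagonal.mem_antidiagonal.1 hq, map_add, map_add]
  omega

theorem isTotalHomogeneous_C_C (c : F) :
    IsTotalHomogeneous (C (C c) : MvPolynomial σv (MvPolynomial σv F)) 0 := by
  classical
  intro m a h
  rw [coeff_C] at h
  split_ifs at h with hm
  · rw [coeff_C] at h
    split_ifs at h with ha
    · simp [← hm, ← ha]
    · simp at h
  · simp at h

theorem isTotalHomogeneous_one :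
    IsTotalHomogeneous (1 : MvPolynomial σv (MvPolynomial σv F)) 0 := by
  simpa using isTotalHomogeneous_C_C (σv := σv) (1 : F)

theorem IsTotalHomogeneous.prod {ι : Type*} (s : Finset ι)
    (G : ι → MvPolynomial σv (MvPolynomial σv F)) (e : ι → ℕ)
    (h : ∀ i ∈ s, IsTotalHomogeneous (G i) (e i)) :
    IsTotalHomogeneous (∏ i ∈ s, G i) (∑ i ∈ s, e i) := by
  classical
  induction s using Finset.induction with
  | empty => simpa using isTotalHomogeneous_one
  | insert a s ha ih =>
    rw [Finset.prod_insert ha, Finset.sum_insert ha]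
    exact (h a (Finset.mem_insert_self a s)).mul
      (ih fun i hi => h i (Finset.mem_insert_of_mem hi))

theorem IsTotalHomogeneous.add {G H : MvPolynomial σv (MvPolynomial σv F)} {e : ℕ}
    (hG : IsTotalHomogeneous G e) (hH : IsTotalHomogeneous H e) :
    IsTotalHomogeneous (G + H) e := by
  intro m a h
  by_contra hne
  have h1 : coeff a (coeff m G) = 0 := by_contra fun h' => hne (hG m a h')
  have h2 : coeff a (coeff m H) = 0 := by_contra fun h' => hne (hH m a h')
  simp [h1, h2] at h

theorem isTotalHomogeneous_zero (e : ℕ) :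
    IsTotalHomogeneous (0 : MvPolynomial σv (MvPolynomial σv F)) e := by
  intro m a h
  simp at h

theorem IsTotalHomogeneous.sum {ι : Type*} (s : Finset ι)
    (G : ι → MvPolynomial σv (MvPolynomial σv F)) (e : ℕ)
    (h : ∀ i ∈ s, IsTotalHomogeneous (G i) e) :
    IsTotalHomogeneous (∑ i ∈ s, G i) e :=
  Finset.sum_induction G (IsTotalHomogeneous · e) (fun _ _ => .add)
    (isTotalHomogeneous_zero e) h

theorem isTotalHomogeneous_X_add_C_X (i : σv) :
    IsTotalHomogeneous (X i + C (X i) : MvPolynomial σv (MvPolynomial σv F)) 1 := by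
  classical
  refine IsTotalHomogeneous.add (fun m a h => ?_) fun m a h => ?_
  · rw [coeff_X] at h
    split_ifs at h with hm
    · rw [coeff_one] at h
      split_ifs at h with ha
      · simp [← hm, ← ha]
      · simp at h
    · simp at h
  · rw [coeff_C] at h
    split_ifs at h with hm
    · rw [coeff_X] at h
      split_ifs at h with ha
      · simp [← hm, ← ha]
      · simp at h
    · simp at h

theorem isTotalHomogeneous_taylorExpansion {P : MvPolynomial σv F} {e : ℕ}
    (hP : P.IsHomogeneous e) : IsTotalHomogeneous (taylorExpansion P) e := by
  classical
  rw [P.as_sum, map_sum]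
  refine IsTotalHomogeneous.sum _ _ _ fun m hm => ?_
  rw [hP.degree_eq_sum_deg_support hm, taylorExpansion, aeval_monomial, Finsupp.prod]
  have hprod := IsTotalHomogeneous.prod m.support
    (fun i => (X i + C (X i) : MvPolynomial σv (MvPolynomial σv F)) ^ m i) m fun i _ => by
      simpa using IsTotalHomogeneous.prod (Finset.range (m i))
        (fun _ => (X i + C (X i) : MvPolynomial σv (MvPolynomial σv F))) (fun _ => 1)
        fun _ _ => isTotalHomogeneous_X_add_C_X i
  simpa using (isTotalHomogeneous_C_C (coeff m P)).mul hprod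

theorem coeff_zero_taylorExpansion (P : MvPolynomial σv F) :
    coeff 0 (taylorExpansion P) = P := by
  induction P using MvPolynomial.induction_on with
  | C a => simp [taylorExpansion, algebraMap_eq, MvPolynomial.algebraMap_apply]
  | add p q hp hq => simp [hp, hq]
  | mul_X p i hp =>
    have hX : taylorExpansion (X i : MvPolynomial σv F) = X i + C (X i) := aeval_X _ _
    rw [map_mul, hX, ← constantCoeff_eq, map_mul, constantCoeff_eq, hp]
    simp

/-- Differentiating a Hasse derivative in `x` raises its order. -/
theorem pderiv_coeff_taylorExpansion (i : σv) (P : MvPolynomial σv F) (m : σv →₀ ℕ) :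
    pderiv i (coeff m (taylorExpansion P)) =
      ((m i + 1 : ℕ) : F) • coeff (m + Finsupp.single i 1) (taylorExpansion P) := by
  classical
  induction P using MvPolynomial.induction_on generalizing m with
  | C a =>
    have hC : taylorExpansion (C a : MvPolynomial σv F) = C (C a) := by
      simp [taylorExpansion, algebraMap_eq, MvPolynomial.algebraMap_apply]
    have hne : (0 : σv →₀ ℕ) ≠ m + Finsupp.single i 1 := fun h => by
      simpa using DFunLike.congr_fun h i
    rw [hC, coeff_C, coeff_C, if_neg hne]
    split_ifs <;> simp
  | add p q hp hq => simp [hp, hq]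
  | mul_X p j hp =>
    have hX : taylorExpansion (X j : MvPolynomial σv F) = X j + C (X j) := aeval_X _ _
    rw [map_mul, hX, mul_add, coeff_add, coeff_add, coeff_mul_X', coeff_mul_X', mul_comm _ (C _),
      coeff_C_mul, coeff_C_mul, map_add, Derivation.leibniz, hp]
    rcases eq_or_ne j i with rfl | hji
    · by_cases hj : j ∈ m.support
      · obtain ⟨m, rfl⟩ : ∃ m', m = m' + Finsupp.single j 1 :=
          ⟨m - Finsupp.single j 1, (tsub_add_cancel_of_le (Finsupp.single_le_iff.2
            (Nat.one_le_iff_ne_zero.2 (Finsupp.mem_support_iff.1 hj)))).symm⟩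
        simp [hp, smul_add, add_smul, smul_eq_mul, mul_add]
        ring
      · have hj' : m j = 0 := by simpa using hj
        simp [hj', smul_eq_mul]
        ring
    · by_cases hj : j ∈ m.support
      · obtain ⟨m, rfl⟩ : ∃ m', m = m' + Finsupp.single j 1 :=
          ⟨m - Finsupp.single j 1, (tsub_add_cancel_of_le (Finsupp.single_le_iff.2
            (Nat.one_le_iff_ne_zero.2 (Finsupp.mem_support_iff.1 hj)))).symm⟩
        simp [hp, hji, add_smul, smul_eq_mul, mul_add, pderiv_X_of_ne hji,
          add_right_comm m (Finsupp.single j 1)]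
      · have hj' : m j = 0 := by simpa using hj
        simp [hj', hji, smul_eq_mul, pderiv_X_of_ne hji]

end Taylor

section HasseSpan

variable {σv F : Type*} [CommRing F]

/-- The span of the Hasse derivatives of `P` of order `j`. -/
noncomputable def hasseSpan (j : ℕ) (P : MvPolynomial σv F) : Submodule F (MvPolynomial σv F) :=
  Submodule.span F {g | ∃ m : σv →₀ ℕ, m.degree = j ∧ coeff m (taylorExpansion P) = g}

theorem pderiv_mem_hasseSpan {j : ℕ} {P g : MvPolynomial σv F} (i : σv)
    (hg : g ∈ hasseSpan j P) : pderiv i g ∈ hasseSpan (j + 1) P := by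
  induction hg using Submodule.span_induction with
  | mem x hx =>
    obtain ⟨m, hm, rfl⟩ := hx
    rw [pderiv_coeff_taylorExpansion]
    exact Submodule.smul_mem _ _ (Submodule.subset_span ⟨_, by simp [hm], rfl⟩)
  | zero => simp
  | add x y _ _ hx hy => simpa using Submodule.add_mem _ hx hy
  | smul a x _ hx => simpa using Submodule.smul_mem _ a hx

theorem pderiv_pow_mem_hasseSpan {j : ℕ} {P g : MvPolynomial σv F} (i : σv) (e : ℕ)
    (hg : g ∈ hasseSpan j P) :
    (((pderiv i).toLinearMap : Module.End F (MvPolynomial σv F)) ^ e) g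
      ∈ hasseSpan (j + e) P := by
  induction e with
  | zero => simpa using hg
  | succ e ih =>
    rw [pow_succ', Module.End.mul_apply]
    exact pderiv_mem_hasseSpan i ih

theorem iterDeriv_mem_hasseSpan (m : σv →₀ ℕ) (P : MvPolynomial σv F) :
    iterDeriv m P ∈ hasseSpan m.degree P := by
  have key : ∀ l : List σv, (l.map fun i =>
      ((pderiv i).toLinearMap : Module.End F (MvPolynomial σv F)) ^ m i).prod P
        ∈ hasseSpan (l.map m).sum P := by
    intro l
    induction l with
    | nil => exact Submodule.subset_span ⟨0, by simp, by simp [coeff_zero_taylorExpansion]⟩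
    | cons i l ih =>
      simp only [List.map_cons, List.prod_cons, Module.End.mul_apply, List.sum_cons]
      rw [add_comm]
      exact pderiv_pow_mem_hasseSpan i _ ih
  have h := key m.support.toList
  rwa [Finset.sum_map_toList] at h

end HasseSpan

section Product

variable {σv F ι : Type*} [CommRing F]

theorem taylorExpansion_eq_sum_homogeneousComponent {P : MvPolynomial σv F} {e : ℕ}
    (hP : P.IsHomogeneous e) :
    taylorExpansion P = ∑ j ∈ Finset.range (e + 1), homogeneousComponent j (taylorExpansion P) := by
  classical
  ext1 m
  simp only [coeff_sum, coeff_homogeneousComponent, Finset.sum_ite_eq]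
  split_ifs with h
  · rfl
  · ext a
    by_contra hne
    have := isTotalHomogeneous_taylorExpansion hP m a hne
    simp only [Finset.mem_range] at h
    omega

theorem IsTotalHomogeneous.homogeneousComponent {G : MvPolynomial σv (MvPolynomial σv F)} {e : ℕ}
    (hG : IsTotalHomogeneous G e) (j : ℕ) :
    IsTotalHomogeneous (homogeneousComponent j G) e := by
  intro m a h
  rw [coeff_homogeneousComponent] at h
  split_ifs at h with hm
  · exact hG m a h
  · simp at h

open Classical in
/-- The part of the Taylor expansion of `P` of those orders `j ≤ e` which satisfy `p`. -/
noncomputable def taylorPart (P : MvPolynomial σv F) (e : ℕ) (p : ℕ → Prop) :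
    MvPolynomial σv (MvPolynomial σv F) :=
  ∑ j ∈ Finset.range (e + 1) with p j, homogeneousComponent j (taylorExpansion P)

theorem taylorPart_add_taylorPart_not {P : MvPolynomial σv F} {e : ℕ}
    (hP : P.IsHomogeneous e) (p : ℕ → Prop) :
    taylorPart P e p + taylorPart P e (fun j => ¬ p j) = taylorExpansion P := by
  classical
  rw [taylorExpansion_eq_sum_homogeneousComponent hP, taylorPart, taylorPart,
    ← Finset.sum_filter_add_sum_filter_not (Finset.range (e + 1)) p]
  congr!

theorem prod_taylorPart_mem_closure {Q : ι → MvPolynomial σv F} {dq : ι → ℕ}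
    (hQ : ∀ i, (Q i).IsHomogeneous (dq i)) (p : ι → ℕ → Prop) (B : Finset ι) :
    ∏ i ∈ B, taylorPart (Q i) (dq i) (p i) ∈ AddSubmonoid.closure
      {G | ∃ κ : ι → ℕ, (∀ i ∈ B, p i (κ i)) ∧ G.IsHomogeneous (∑ i ∈ B, κ i) ∧
        IsTotalHomogeneous G (∑ i ∈ B, dq i)} := by
  classical
  simp only [taylorPart]
  rw [Finset.prod_sum]
  refine sum_mem fun κ hκ => AddSubmonoid.subset_closure
    ⟨fun i => if h : i ∈ B then κ i h else 0, fun i hi => ?_, ?_, ?_⟩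
  · simpa [hi] using (Finset.mem_filter.1 (Finset.mem_pi.1 hκ i hi)).2
  · rw [← Finset.sum_attach]
    simp only [Finset.coe_mem, dif_pos]
    exact IsHomogeneous.prod _ _ _ fun x _ => homogeneousComponent_isHomogeneous _ _
  · rw [← Finset.sum_attach]
    exact IsTotalHomogeneous.prod _ _ _ fun x _ =>
      (isTotalHomogeneous_taylorExpansion (hQ x)).homogeneousComponent _

variable [Fintype σv] [DecidableEq σv] [Fintype ι] [DecidableEq ι]

open Classical in
/-- A finite set spanning the shifted partials of `∏ i, Q i`: shifts of Hasse derivatives of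
subproducts `∏ i ∈ S, Q i`, where the factors outside `S` absorb `K` derivatives. -/
noncomputable def productSpanningSet (k ℓ : ℕ) (γ : ℝ) (Q : ι → MvPolynomial σv F) (dq : ι → ℕ) :
    Finset (MvPolynomial σv F) :=
  {w ∈ (Finset.univ : Finset (Finset ι)) ×ˢ Finset.range (k + 1) |
      w.2 ≤ ∑ i ∈ w.1ᶜ, dq i ∧
      γ + (k : ℝ) / ((∑ i, dq i : ℕ) : ℝ) * ((∑ i ∈ w.1ᶜ, dq i : ℕ) : ℝ) ≤ w.2}.biUnion fun w =>
    ((Finset.univ.finsuppAntidiag (ℓ + (∑ i ∈ w.1ᶜ, dq i - w.2))) ×ˢ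
      (Finset.univ.finsuppAntidiag (k - w.2))).image fun am =>
        monomial am.1 1 * coeff am.2 (taylorExpansion (∏ i ∈ w.1, Q i))

theorem monomial_mul_coeff_mul_mem_span {k ℓ : ℕ} {γ : ℝ} {Q : ι → MvPolynomial σv F}
    {dq : ι → ℕ} {S : Finset ι} {K : ℕ} {G : MvPolynomial σv (MvPolynomial σv F)}
    (hG : G.IsHomogeneous K) (hGt : IsTotalHomogeneous G (∑ i ∈ Sᶜ, dq i))
    (hK : γ + (k : ℝ) / ((∑ i, dq i : ℕ) : ℝ) * ((∑ i ∈ Sᶜ, dq i : ℕ) : ℝ) ≤ K)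
    {m c : σv →₀ ℕ} (hm : m.degree = k) (hc : c.degree = ℓ) :
    monomial c 1 * coeff m (G * taylorExpansion (∏ i ∈ S, Q i)) ∈
      Submodule.span F (productSpanningSet k ℓ γ Q dq : Set (MvPolynomial σv F)) := by
  rw [coeff_mul, Finset.mul_sum]
  refine Submodule.sum_mem _ fun p hp => ?_
  have hadd : p.1.degree + p.2.degree = k := by
    rw [← map_add, Finset.HasAntidiagonal.mem_antidiagonal.1 hp, hm]
  by_cases hdeg : p.1.degree = K
  · rw [(coeff p.1 G).as_sum, Finset.sum_mul, Finset.mul_sum]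
    refine Submodule.sum_mem _ fun a ha => ?_
    have hta := hGt _ _ (mem_support_iff.1 ha)
    have heq : monomial c 1 * (monomial a (coeff a (coeff p.1 G)) *
        coeff p.2 (taylorExpansion (∏ i ∈ S, Q i))) =
        coeff a (coeff p.1 G) •
          (monomial (c + a) 1 * coeff p.2 (taylorExpansion (∏ i ∈ S, Q i))) := by
      rw [← mul_assoc, monomial_mul, one_mul, ← smul_mul_assoc, smul_monomial, smul_eq_mul,
        mul_one]
    rw [heq]
    refine Submodule.smul_mem _ _ (Submodule.subset_span ?_)
    simp only [productSpanningSet, Finset.coe_biUnion, Set.mem_iUnion, Finset.coe_image]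
    refine ⟨(S, K), ?_, (c + a, p.2), ?_, rfl⟩
    · simp only [Finset.coe_filter, Set.mem_ofPred_eq, Finset.mem_product, Finset.mem_univ,
        Finset.mem_range, true_and]
      exact ⟨by omega, by omega, hK⟩
    · simp only [Finset.coe_product, Set.mem_prod, Finset.mem_coe, Finset.mem_finsuppAntidiag,
        Finset.subset_univ, and_true, ← Finsupp.degree_eq_sum, map_add]
      exact ⟨by omega, by omega⟩
  · rw [hG.coeff_eq_zero hdeg]
    simp

theorem residue_le_excess_s7 {k : ℕ} {γ : ℝ} {dq : ι → ℕ} (hd : 0 < ∑ i, dq i)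
    (hres : ∀ κ : ι → ℤ,
      2 * γ ≤ ∑ i, |(κ i : ℝ) - (k : ℝ) / ((∑ i, dq i : ℕ) : ℝ) * (dq i : ℝ)|)
    {B : Finset ι} {κ μ : ι → ℕ} (hκ : ∀ i ∈ B, k * dq i < κ i * ∑ i, dq i)
    (hμ : ∀ i ∈ Bᶜ, ¬ k * dq i < μ i * ∑ i, dq i) (hsum : ∑ i ∈ B, κ i + ∑ i ∈ Bᶜ, μ i = k) :
    γ + (k : ℝ) / ((∑ i, dq i : ℕ) : ℝ) * ((∑ i ∈ B, dq i : ℕ) : ℝ) ≤ (∑ i ∈ B, κ i : ℕ) := by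
  have hsplit : ∑ i ∈ B, dq i + ∑ i ∈ Bᶜ, dq i = ∑ i, dq i := Finset.sum_add_sum_compl B dq
  set d := ∑ i, dq i
  have hd' : (0 : ℝ) < d := by exact_mod_cast hd
  have h := hres fun i => if i ∈ B then κ i else μ i
  rw [← Finset.sum_add_sum_compl B] at h
  have h1 : ∑ i ∈ B, |(((if i ∈ B then κ i else μ i : ℕ) : ℤ) : ℝ) - (k : ℝ) / d * (dq i : ℝ)| =
      ∑ i ∈ B, ((κ i : ℝ) - (k : ℝ) / d * (dq i : ℝ)) := by
    refine Finset.sum_congr rfl fun i hi => ?_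
    have : (k : ℝ) * dq i < κ i * d := by exact_mod_cast hκ i hi
    rw [if_pos hi, abs_of_nonneg]
    · simp
    · rw [div_mul_eq_mul_div, sub_nonneg, div_le_iff₀ hd']
      simpa using this.le
  have h2 : ∑ i ∈ Bᶜ, |(((if i ∈ B then κ i else μ i : ℕ) : ℤ) : ℝ) - (k : ℝ) / d * (dq i : ℝ)| =
      ∑ i ∈ Bᶜ, ((k : ℝ) / d * (dq i : ℝ) - (μ i : ℝ)) := by
    refine Finset.sum_congr rfl fun i hi => ?_
    have : (μ i : ℝ) * d ≤ k * dq i := by exact_mod_cast not_lt.1 (hμ i hi)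
    rw [if_neg (Finset.mem_compl.1 hi), abs_of_nonpos]
    · simp
    · rw [div_mul_eq_mul_div, sub_nonpos, le_div_iff₀ hd']
      simpa using this
  push_cast at h h1 h2
  rw [h1, h2, Finset.sum_sub_distrib, Finset.sum_sub_distrib, ← Finset.mul_sum,
    ← Finset.mul_sum] at h
  have hs : ∑ i ∈ B, (κ i : ℝ) + ∑ i ∈ Bᶜ, (μ i : ℝ) = k := by exact_mod_cast hsum
  have hdd : (k : ℝ) / d * ∑ i ∈ B, (dq i : ℝ) + (k : ℝ) / d * ∑ i ∈ Bᶜ, (dq i : ℝ) = k := by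
    rw [← mul_add]
    have : ∑ i ∈ B, (dq i : ℝ) + ∑ i ∈ Bᶜ, (dq i : ℝ) = d := by exact_mod_cast hsplit
    rw [this, div_mul_cancel₀ _ hd'.ne']
  push_cast
  linarith

theorem monomial_mul_coeff_taylorExpansion_prod_mem_span {k ℓ : ℕ} {γ : ℝ}
    {Q : ι → MvPolynomial σv F} {dq : ι → ℕ} (hQ : ∀ i, (Q i).IsHomogeneous (dq i))
    (hd : 0 < ∑ i, dq i)
    (hres : ∀ κ : ι → ℤ,
      2 * γ ≤ ∑ i, |(κ i : ℝ) - (k : ℝ) / ((∑ i, dq i : ℕ) : ℝ) * (dq i : ℝ)|)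
    {m c : σv →₀ ℕ} (hm : m.degree = k) (hc : c.degree = ℓ) :
    monomial c 1 * coeff m (taylorExpansion (∏ i, Q i)) ∈
      Submodule.span F (productSpanningSet k ℓ γ Q dq : Set (MvPolynomial σv F)) := by
  set p : ι → ℕ → Prop := fun i j => k * dq i < j * ∑ i, dq i
  set W := Submodule.span F (productSpanningSet k ℓ γ Q dq : Set (MvPolynomial σv F))
  have hlow : ∀ i, taylorPart (Q i) (dq i) (fun j => ¬ p i j) =
      taylorExpansion (Q i) + -1 * taylorPart (Q i) (dq i) (p i) := fun i => by
    rw [← taylorPart_add_taylorPart_not (hQ i) (p i)]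
    ring
  rw [map_prod, Finset.prod_congr rfl fun i _ =>
    (taylorPart_add_taylorPart_not (hQ i) (p i)).symm, Finset.prod_add, coeff_sum, Finset.mul_sum]
  refine Submodule.sum_mem _ fun B _ => ?_
  rw [← Finset.compl_eq_univ_sdiff]
  refine AddSubmonoid.closure_induction (motive := fun G _ => monomial c 1 * coeff m (G *
    ∏ i ∈ Bᶜ, taylorPart (Q i) (dq i) (fun j => ¬ p i j)) ∈ W) ?_ (by simp)
    (fun x y _ _ hx hy => by simpa [add_mul, mul_add] using W.add_mem hx hy)
    (prod_taylorPart_mem_closure hQ p B)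
  rintro G ⟨κ, hκ, hG, hGt⟩
  by_cases hμ : ∃ μ : ι → ℕ, (∀ i ∈ Bᶜ, ¬ p i (μ i)) ∧ ∑ i ∈ B, κ i + ∑ i ∈ Bᶜ, μ i = k
  · obtain ⟨μ, hμ, hsum⟩ := hμ
    have hex := residue_le_excess_s7 hd hres hκ hμ hsum
    simp only [hlow]
    rw [Finset.prod_add, Finset.mul_sum, coeff_sum, Finset.mul_sum]
    refine Submodule.sum_mem _ fun S hS => ?_
    rw [Finset.prod_mul_distrib, Finset.prod_const]
    refine AddSubmonoid.closure_induction (motive := fun H _ => monomial c 1 * coeff m (G *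
      ((∏ i ∈ S, taylorExpansion (Q i)) * ((-1) ^ (Bᶜ \ S).card * H))) ∈ W) ?_ (by simp)
      (fun x y _ _ hx hy => by simpa [mul_add] using W.add_mem hx hy)
      (prod_taylorPart_mem_closure hQ p (Bᶜ \ S))
    rintro H ⟨κ', hκ', hH, hHt⟩
    have hdisj : Disjoint B (Bᶜ \ S) :=
      disjoint_compl_right.mono_right Finset.sdiff_subset
    have hcompl : Sᶜ = B ∪ (Bᶜ \ S) := by
      ext i
      have hSB : i ∈ S → i ∈ Bᶜ := fun hi => Finset.mem_powerset.1 hS hi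
      simp only [Finset.mem_compl, Finset.mem_union, Finset.mem_sdiff] at hSB ⊢
      tauto
    have hGH := monomial_mul_coeff_mul_mem_span (k := k) (ℓ := ℓ) (γ := γ) (Q := Q) (dq := dq)
      (S := S) (hG.mul hH) (by
        rw [hcompl, Finset.sum_union hdisj]
        exact hGt.mul hHt) (by
        rw [hcompl, Finset.sum_union hdisj]
        have hd' : (0 : ℝ) < (∑ i, dq i : ℕ) := by exact_mod_cast hd
        have : (k : ℝ) / ((∑ i, dq i : ℕ) : ℝ) * ((∑ i ∈ Bᶜ \ S, dq i : ℕ) : ℝ) ≤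
            (∑ i ∈ Bᶜ \ S, κ' i : ℕ) := by
          rw [div_mul_eq_mul_div, div_le_iff₀ hd']
          have : k * ∑ i ∈ Bᶜ \ S, dq i ≤ (∑ i ∈ Bᶜ \ S, κ' i) * ∑ i, dq i := by
            rw [Finset.mul_sum, Finset.sum_mul]
            exact Finset.sum_le_sum fun i hi => (hκ' i hi).le
          exact_mod_cast this
        push_cast at this hex ⊢
        rw [mul_add]
        linarith) hm hc
    rw [map_prod] at hGH
    rcases neg_one_pow_eq_or (MvPolynomial σv (MvPolynomial σv F)) (Bᶜ \ S).card with h | h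
    · rw [h, one_mul, mul_comm _ H, ← mul_assoc]
      exact hGH
    · rw [h, neg_one_mul, mul_neg, mul_neg, mul_comm _ H, ← mul_assoc, coeff_neg, mul_neg]
      exact W.neg_mem hGH
  · suffices h : coeff m (G * ∏ i ∈ Bᶜ, taylorPart (Q i) (dq i) (fun j => ¬ p i j)) = 0 by
      simp [h]
    refine AddSubmonoid.closure_induction (motive := fun H _ => coeff m (G * H) = 0) ?_ (by simp)
      (fun x y _ _ hx hy => by simp [mul_add, hx, hy])
      (prod_taylorPart_mem_closure hQ (fun i j => ¬ p i j) Bᶜ)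
    rintro H ⟨μ, hμ', hH, -⟩
    exact (hG.mul hH).coeff_eq_zero fun h => hμ ⟨μ, hμ', by rw [← h, hm]⟩

end Product

section Counting

theorem M_succ_mul (n e : ℕ) (hn : 1 ≤ n) : M n (e + 1) * (e + 1) = M n e * (n + e) := by
  obtain ⟨n, rfl⟩ := Nat.exists_eq_add_of_le' hn
  have h := Nat.add_one_mul_choose_eq (n + e) e
  simp only [M]
  rw [show n + 1 + (e + 1) - 1 = n + e + 1 by omega, show n + 1 + e - 1 = n + e by omega, ← h]
  ring

theorem M_add_le {n n0 d ℓ : ℕ} (hn : 1 ≤ n) (hd : 1 ≤ d) (hdn : d ≤ n0) (hℓ : ℓ = n * d / n0)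
    (e : ℕ) : (M n (ℓ + e) : ℝ) ≤ (2 * (n0 / d : ℝ)) ^ e * M n ℓ := by
  have hd' : (0 : ℝ) < d := by exact_mod_cast hd
  have hquot : (1 : ℝ) ≤ n0 / d := by
    rw [one_le_div hd']
    exact_mod_cast hdn
  have hfloor : (n : ℝ) ≤ n0 / d * (ℓ + 1) := by
    have h : n * d < n0 * (ℓ + 1) := by
      rw [hℓ]
      exact Nat.lt_mul_div_succ _ (by omega)
    rw [div_mul_eq_mul_div, le_div_iff₀ hd']
    exact_mod_cast h.le
  induction e with
  | zero => simp
  | succ e ih =>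
    have h : (M n (ℓ + e + 1) : ℝ) * (ℓ + e + 1) = M n (ℓ + e) * (n + (ℓ + e)) := by
      exact_mod_cast M_succ_mul n (ℓ + e) hn
    have hpos : (0 : ℝ) < ℓ + e + 1 := by positivity
    have hstep : (n + (ℓ + e) : ℝ) ≤ 2 * (n0 / d) * (ℓ + e + 1) := by
      have he : (0 : ℝ) ≤ e := by positivity
      have hℓ' : (0 : ℝ) ≤ ℓ := by positivity
      nlinarith
    have hM : (M n (ℓ + e + 1) : ℝ) ≤ M n (ℓ + e) * (2 * (n0 / d)) := by
      refine le_of_mul_le_mul_right ?_ hpos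
      rw [h, mul_assoc]
      exact mul_le_mul_of_nonneg_left hstep (by positivity)
    calc (M n (ℓ + (e + 1)) : ℝ) ≤ M n (ℓ + e) * (2 * (n0 / d)) := hM
      _ ≤ ((2 * (n0 / d : ℝ)) ^ e * M n ℓ) * (2 * (n0 / d)) :=
        mul_le_mul_of_nonneg_right ih (by positivity)
      _ = _ := by ring

theorem pow_div_le_M {n k : ℕ} (hn : 1 ≤ n) : ((n : ℝ) / k) ^ k ≤ M n k := by
  have h := Nat.pow_le_choose (α := ℝ) k (n + k - 1)
  rw [show n + k - 1 + 1 - k = n by omega] at h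
  refine le_trans ?_ h
  rw [div_pow]
  refine div_le_div_of_nonneg_left (by positivity) (by positivity) ?_
  exact_mod_cast Nat.factorial_le_pow k

theorem M_le_pow_div {n k k0 : ℕ} (hk : 1 ≤ k) (hkn : k ≤ n) (hk0 : k0 ≤ k) :
    (M n k0 : ℝ) ≤ 6 ^ k * ((n : ℝ) / k) ^ k0 := by
  have hk' : (0 : ℝ) < k := by exact_mod_cast hk
  have h1 : (M n k0 : ℝ) ≤ ((n + k0 - 1 : ℕ) : ℝ) ^ k0 / (k0.factorial : ℝ) :=
    Nat.choose_le_pow_div k0 (n + k0 - 1)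
  have h2 : ((n + k0 - 1 : ℕ) : ℝ) ≤ 2 * n := by
    have : n + k0 - 1 ≤ 2 * n := by omega
    exact_mod_cast this
  have h3 : (k : ℝ) ^ k0 / k0.factorial ≤ 3 ^ k := by
    refine (Real.pow_div_factorial_le_exp _ hk'.le k0).trans ?_
    rw [← Real.exp_one_rpow, Real.rpow_natCast]
    exact pow_le_pow_left₀ (Real.exp_pos 1).le Real.exp_one_lt_three.le k
  calc (M n k0 : ℝ) ≤ (2 * n : ℝ) ^ k0 / k0.factorial :=
        h1.trans (by gcongr)
    _ = 2 ^ k0 * ((k : ℝ) ^ k0 / k0.factorial) * ((n : ℝ) / k) ^ k0 := by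
        rw [mul_pow, div_pow]
        field_simp
    _ ≤ 2 ^ k * 3 ^ k * ((n : ℝ) / k) ^ k0 := by
        gcongr
        norm_num
    _ = _ := by rw [← mul_pow]; norm_num

/-- The contribution of a subproduct whose complement has degree `e` and absorbs `K` derivatives. -/
theorem M_mul_M_le {n d k n0 ℓ e K : ℕ} {γ : ℝ} (hk : 1 ≤ k) (hkd : 2 * k < d) (hdn : d ≤ n0)
    (hn : n0 ≤ n)
    (hn0 : (n0 : ℝ) ≤
      2 * ((d : ℝ) - (k : ℝ)) * ((n : ℝ) / (k : ℝ)) ^ ((k : ℝ) / ((d : ℝ) - (k : ℝ))))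
    (hℓ : ℓ = n * d / n0) (hγ : 0 < γ) (hed : e ≤ d) (hKk : K ≤ k) (hKe : K ≤ e)
    (hK : γ + (k : ℝ) / d * e ≤ K) :
    (M n (k - K) : ℝ) * M n (ℓ + (e - K)) ≤
      24 ^ d * ((n : ℝ) / d) ^ (-γ) * (M n k * M n ℓ) := by
  have hd1 : 1 ≤ d := by omega
  have hk' : (0 : ℝ) < k := by exact_mod_cast hk
  have hd' : (0 : ℝ) < d := by exact_mod_cast hd1
  have hdk : (0 : ℝ) < (d : ℝ) - k := by
    have : (k : ℝ) < d := by exact_mod_cast (by omega : k < d)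
    linarith
  set r : ℝ := (n : ℝ) / k
  have hnd : (1 : ℝ) ≤ (n : ℝ) / d := by
    rw [one_le_div hd']
    exact_mod_cast hdn.trans hn
  have hrd : (n : ℝ) / d ≤ r := by
    refine div_le_div_of_nonneg_left (by positivity) hk' ?_
    exact_mod_cast (by omega : k ≤ d)
  have hr1 : 1 ≤ r := hnd.trans hrd
  have hr0 : 0 < r := by linarith
  set θ : ℝ := (k : ℝ) / ((d : ℝ) - k) with hθ
  have hquot : (2 : ℝ) * (n0 / d) ≤ 4 * r ^ θ := by
    have : (n0 : ℝ) / d ≤ 2 * r ^ θ := by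
      rw [div_le_iff₀ hd']
      have hpos : 0 < r ^ θ := Real.rpow_pos_of_pos hr0 _
      nlinarith
    linarith
  have hexp : (((k - K : ℕ) : ℝ) + θ * ((e - K : ℕ) : ℝ)) ≤ k + -γ := by
    rw [Nat.cast_sub hKk, Nat.cast_sub hKe, hθ, div_mul_eq_mul_div]
    have hKd : γ * d + k * e ≤ K * d := by
      have := mul_le_mul_of_nonneg_right hK hd'.le
      rw [add_mul, div_mul_eq_mul_div, div_mul_cancel₀ _ hd'.ne'] at this
      exact this
    have : (k : ℝ) * (e - K) / (d - k) ≤ K - γ := by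
      rw [div_le_iff₀ hdk]
      nlinarith
    linarith
  have h1 := M_le_pow_div hk (by omega : k ≤ n) (Nat.sub_le k K)
  have h2 := M_add_le (by omega : 1 ≤ n) hd1 hdn hℓ (e - K)
  calc (M n (k - K) : ℝ) * M n (ℓ + (e - K))
      ≤ (6 ^ k * r ^ (k - K)) * ((4 * r ^ θ) ^ (e - K) * M n ℓ) := by
        refine mul_le_mul h1 (h2.trans ?_) (by positivity) (by positivity)
        gcongr
    _ = 6 ^ k * 4 ^ (e - K) * r ^ (((k - K : ℕ) : ℝ) + θ * ((e - K : ℕ) : ℝ)) * M n ℓ := by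
        rw [Real.rpow_add hr0, Real.rpow_natCast, Real.rpow_mul hr0.le, Real.rpow_natCast, mul_pow]
        ring
    _ ≤ 6 ^ d * 4 ^ d * r ^ (k + -γ) * M n ℓ := by
        gcongr
        · norm_num
        · omega
        · norm_num
        · omega
    _ = 24 ^ d * r ^ (-γ) * (r ^ k * M n ℓ) := by
        rw [Real.rpow_add hr0, Real.rpow_natCast, ← mul_pow]
        norm_num
        ring
    _ ≤ 24 ^ d * ((n : ℝ) / d) ^ (-γ) * (M n k * M n ℓ) := by
        gcongr ?_ * ?_ * (?_ * _)
        · exact Real.rpow_le_rpow_of_nonpos (by linarith) hrd (by linarith)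
        · exact pow_div_le_M (by omega)

end Counting

section Rank

theorem card_productSpanningSet_le {F : Type*} [CommRing F] {n d k n0 ℓ t : ℕ} {γ : ℝ}
    (Q : Fin t → MvPolynomial (Fin n) F) {dq : Fin t → ℕ}
    (hpos : ∀ j, 1 ≤ dq j) (hdeg : ∑ j, dq j = d) (hk : 1 ≤ k) (hkd : 2 * k < d) (hdn : d ≤ n0)
    (hn : n0 ≤ n)
    (hn0 : (n0 : ℝ) ≤
      2 * ((d : ℝ) - (k : ℝ)) * ((n : ℝ) / (k : ℝ)) ^ ((k : ℝ) / ((d : ℝ) - (k : ℝ))))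
    (hℓ : ℓ = n * d / n0) (hγ : 0 < γ) :
    ((productSpanningSet k ℓ γ Q dq).card : ℝ) ≤
      96 ^ d * ((n : ℝ) / d) ^ (-γ) * (M n k * M n ℓ) := by
  classical
  have hcard : ∀ e, ((Finset.univ : Finset (Fin n)).finsuppAntidiag e).card = M n e := fun e => by
    rw [Finset.card_finsuppAntidiag_nat_eq_choose, Finset.card_univ, Fintype.card_fin, M]
  set bd : ℝ := 24 ^ d * ((n : ℝ) / d) ^ (-γ) * (M n k * M n ℓ) with hbd
  have hbd0 : 0 ≤ bd := by positivity
  have htd : t ≤ d := by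
    rw [← hdeg]
    simpa using Finset.sum_le_sum fun j (_ : j ∈ Finset.univ) => hpos j
  rw [productSpanningSet]
  refine (Nat.cast_le.2 (Finset.card_biUnion_le)).trans ?_
  rw [Nat.cast_sum]
  refine (Finset.sum_le_card_nsmul _ _ bd fun w hw => ?_).trans ?_
  · simp only [Finset.mem_filter, Finset.mem_product, Finset.mem_univ, true_and,
      Finset.mem_range] at hw
    obtain ⟨hwk, hwe, hw⟩ := hw
    refine (Nat.cast_le.2 Finset.card_image_le).trans ?_
    rw [Finset.card_product, hcard, hcard, mul_comm, Nat.cast_mul]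
    refine M_mul_M_le hk hkd hdn hn hn0 hℓ hγ ?_ (by omega) hwe (by rwa [hdeg] at hw)
    rw [← hdeg]
    exact Finset.sum_le_univ_sum_of_nonneg fun _ => Nat.zero_le _
  · rw [nsmul_eq_mul]
    have hnum : (Finset.univ ×ˢ Finset.range (k + 1) : Finset (Finset (Fin t) × ℕ)).card ≤
        4 ^ d := by
      rw [Finset.card_product, Finset.card_univ, Fintype.card_finset, Fintype.card_fin,
        Finset.card_range, show 4 = 2 * 2 by rfl, mul_pow]
      exact Nat.mul_le_mul (Nat.pow_le_pow_right (by norm_num) htd)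
        (Nat.lt_two_pow_self.le.trans' (by omega : k + 1 ≤ d))
    calc _ ≤ ((4 ^ d : ℕ) : ℝ) * bd :=
          mul_le_mul_of_nonneg_right (Nat.cast_le.2 ((Finset.card_filter_le _ _).trans hnum)) hbd0
      _ = _ := by
          rw [hbd, show (96 : ℝ) = 4 * 24 by norm_num, mul_pow]
          push_cast
          ring

theorem eq_sum_filter_of_isHomogeneous {σv F : Type*} [CommRing F] {d s : ℕ} {t : Fin s → ℕ}
    {Q : ∀ i : Fin s, Fin (t i) → MvPolynomial σv F} {dq : ∀ i : Fin s, Fin (t i) → ℕ}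
    (hQ : ∀ i j, (Q i j).IsHomogeneous (dq i j)) {P : MvPolynomial σv F}
    (hP : P = ∑ i, ∏ j, Q i j) (hPd : P.IsHomogeneous d) :
    P = ∑ i with ∑ j, dq i j = d, ∏ j, Q i j := by
  rw [← homogeneousComponent_eq_self hPd, hP, map_sum, Finset.sum_filter]
  refine Finset.sum_congr rfl fun i _ => ?_
  rw [homogeneousComponent_of_mem
    ((mem_homogeneousSubmodule _ _).2 (IsHomogeneous.prod _ _ _ fun j _ => hQ i j))]
  simp only [eq_comm]

theorem SP_le_sum_card {F : Type*} [Field F] {n d s k ℓ : ℕ} {γ : ℝ} {t : Fin s → ℕ}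
    {Q : ∀ i : Fin s, Fin (t i) → MvPolynomial (Fin n) F} {dq : ∀ i : Fin s, Fin (t i) → ℕ}
    (hQ : ∀ i j, (Q i j).IsHomogeneous (dq i j)) (hd : 1 ≤ d)
    {P : MvPolynomial (Fin n) F} (hP : P = ∑ i with ∑ j, dq i j = d, ∏ j, Q i j)
    (hres : ∀ i, γ ≤ residue k (dq i)) :
    SP k ℓ P ≤ ∑ i with ∑ j, dq i j = d, (productSpanningSet k ℓ γ (Q i) (dq i)).card := by
  classical
  set I : Finset (Fin s) := {i | ∑ j, dq i j = d}
  set W : Finset (MvPolynomial (Fin n) F) :=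
    I.biUnion fun i => productSpanningSet k ℓ γ (Q i) (dq i)
  have hres' : ∀ i, ∀ κ : Fin (t i) → ℤ, 2 * γ ≤
      ∑ j, |(κ j : ℝ) - (k : ℝ) / ((∑ j, dq i j : ℕ) : ℝ) * (dq i j : ℝ)| := fun i κ => by
    have h := hres i
    rw [residue] at h
    have hinf := csInf_le (a := ∑ j, |(κ j : ℝ) -
      (k : ℝ) / ((∑ j, dq i j : ℕ) : ℝ) * (dq i j : ℝ)|)
      (s := { r : ℝ | ∃ κ : Fin (t i) → ℤ,
        r = ∑ j, |(κ j : ℝ) - ((k : ℝ) / ((∑ j, dq i j : ℕ) : ℝ)) * (dq i j : ℝ)| })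
      ⟨0, by
        rintro _ ⟨κ, rfl⟩
        exact Finset.sum_nonneg fun _ _ => abs_nonneg _⟩ ⟨κ, rfl⟩
    linarith
  have hsub : Submodule.span F (shiftedPartialsSet ℓ k P) ≤
      Submodule.span F (W : Set (MvPolynomial (Fin n) F)) := by
    rw [Submodule.span_le]
    rintro _ ⟨c, hc, _, ⟨m, hm, rfl⟩, rfl⟩
    have hmem : iterDeriv m P ∈ hasseSpan k P := by
      have h := iterDeriv_mem_hasseSpan m P
      rwa [show m.degree = k from hm] at h
    generalize iterDeriv m P = g at hmem
    show monomial c 1 * g ∈ _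
    induction hmem using Submodule.span_induction with
    | mem x hx =>
      obtain ⟨m', hm', rfl⟩ := hx
      rw [hP, map_sum, coeff_sum, Finset.mul_sum]
      refine Submodule.sum_mem _ fun i hi => ?_
      have hi' : ∑ j, dq i j = d := (Finset.mem_filter.1 hi).2
      refine Submodule.span_mono (Finset.coe_subset.2 (Finset.subset_biUnion_of_mem
        (fun i => productSpanningSet k ℓ γ (Q i) (dq i)) hi)) ?_
      exact monomial_mul_coeff_taylorExpansion_prod_mem_span (hQ i) (by omega) (hres' i) hm' hc
    | zero => simp
    | add x y _ _ hx hy => simpa [mul_add] using Submodule.add_mem _ hx hy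
    | smul a x _ hx => simpa using Submodule.smul_mem _ a hx
  calc SP k ℓ P ≤ Module.finrank F (Submodule.span F (W : Set (MvPolynomial (Fin n) F))) :=
        Submodule.finrank_mono hsub
    _ ≤ W.card := finrank_span_finset_le_card W
    _ ≤ _ := Finset.card_biUnion_le

end Rank

/-- high residue implies lower bounds, via shifted partials. -/
theorem stmt7 : ∃ c2 : ℝ, 0 < c2 ∧ ∃ c3 : ℝ, 0 < c3 ∧ ∀ c1 : ℝ, 0 ≤ c1 →
    ∀ (F : Type*) [Field F], ∀ (n d s : ℕ) (t : Fin s → ℕ)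
      (Q : ∀ i : Fin s, Fin (t i) → MvPolynomial (Fin n) F)
      (dq : ∀ i : Fin s, Fin (t i) → ℕ),
      (∀ i j, (Q i j).IsHomogeneous (dq i j)) → (∀ i j, 1 ≤ dq i j) →
      (∀ i j, Q i j ≠ 0) →
      ∀ P : MvPolynomial (Fin n) F, P = ∑ i, ∏ j, Q i j →
      P.IsHomogeneous d → 1 ≤ d →
      ∀ k : ℕ, 1 ≤ k → 2 * k < d →
      ∀ n0 : ℕ, d ≤ n0 → n0 ≤ n →
        ((d : ℝ) - (k : ℝ)) * ((n : ℝ) / (k : ℝ)) ^ ((k : ℝ) / ((d : ℝ) - (k : ℝ))) ≤ (n0 : ℝ) →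
        (n0 : ℝ) ≤ 2 * ((d : ℝ) - (k : ℝ)) * ((n : ℝ) / (k : ℝ)) ^ ((k : ℝ) / ((d : ℝ) - (k : ℝ))) →
      ∀ ℓ : ℕ, ℓ = n * d / n0 →
      (2 : ℝ) ^ (-(c1 * (d : ℝ))) * (M n k : ℝ) * (M n ℓ : ℝ) ≤ (SP k ℓ P : ℝ) →
      ∀ γ : ℝ, 0 < γ → (∀ i : Fin s, γ ≤ residue k (dq i)) →
      (2 : ℝ) ^ (-((c1 + c2) * (d : ℝ))) * ((n : ℝ) / (d : ℝ)) ^ (c3 * γ) ≤ (s : ℝ) := by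
  refine ⟨10, by norm_num, 1, one_pos, ?_⟩
  intro c1 _ F _ n d s t Q dq hQ hpos _ P hP hPd hd k hk hkd n0 hdn hn _ hn0 ℓ hℓ hSP γ hγ hres
  have hSP' := SP_le_sum_card (k := k) (ℓ := ℓ) hQ hd
    (eq_sum_filter_of_isHomogeneous hQ hP hPd) hres
  set T : ℝ := 96 ^ d * ((n : ℝ) / d) ^ (-γ) * (M n k * M n ℓ) with hT
  have hT0 : 0 ≤ T := by positivity
  have hupper : (SP k ℓ P : ℝ) ≤ s * T := by
    refine (Nat.cast_le.2 hSP').trans ?_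
    push_cast
    refine (Finset.sum_le_card_nsmul _ _ T fun i hi => card_productSpanningSet_le (Q i) (hpos i)
      (Finset.mem_filter.1 hi).2 hk hkd hdn hn hn0 hℓ hγ).trans ?_
    rw [nsmul_eq_mul]
    refine mul_le_mul_of_nonneg_right (Nat.cast_le.2 ?_) hT0
    simpa using Finset.card_filter_le (Finset.univ : Finset (Fin s)) fun i => ∑ j, dq i j = d
  have hMpos : (0 : ℝ) < M n k * M n ℓ := by
    have h : ∀ e, 0 < M n e := fun e => Nat.choose_pos (by omega)
    exact_mod_cast Nat.mul_pos (h k) (h ℓ)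
  have hnd : (0 : ℝ) < (n : ℝ) / d := by
    have : 0 < n := by omega
    positivity
  have hlow : (2 : ℝ) ^ (-(c1 * (d : ℝ))) ≤ s * (96 ^ d * ((n : ℝ) / d) ^ (-γ)) := by
    refine le_of_mul_le_mul_right ?_ hMpos
    calc _ = (2 : ℝ) ^ (-(c1 * (d : ℝ))) * (M n k : ℝ) * (M n ℓ : ℝ) := by ring
      _ ≤ s * T := hSP.trans hupper
      _ = _ := by rw [hT]; ring
  have hbase : (2 : ℝ) ^ (-(10 * (d : ℝ))) * 96 ^ d ≤ 1 := by
    rw [Real.rpow_neg (by norm_num), Real.rpow_mul (by norm_num), Real.rpow_natCast,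
      inv_mul_le_one₀ (by positivity)]
    exact pow_le_pow_left₀ (by norm_num) (by norm_num) d
  calc (2 : ℝ) ^ (-((c1 + 10) * (d : ℝ))) * ((n : ℝ) / d) ^ (1 * γ)
      = (2 : ℝ) ^ (-(c1 * (d : ℝ))) * ((2 : ℝ) ^ (-(10 * (d : ℝ))) * ((n : ℝ) / d) ^ γ) := by
        rw [one_mul, ← mul_assoc, ← Real.rpow_add (by norm_num)]
        ring_nf
    _ ≤ s * (96 ^ d * ((n : ℝ) / d) ^ (-γ)) *
          ((2 : ℝ) ^ (-(10 * (d : ℝ))) * ((n : ℝ) / d) ^ γ) :=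
        mul_le_mul_of_nonneg_right hlow (by positivity)
    _ = s * ((2 : ℝ) ^ (-(10 * (d : ℝ))) * 96 ^ d) *
          (((n : ℝ) / d) ^ (-γ) * ((n : ℝ) / d) ^ γ) := by
        ring
    _ = s * ((2 : ℝ) ^ (-(10 * (d : ℝ))) * 96 ^ d) := by
        rw [← Real.rpow_add hnd, neg_add_cancel, Real.rpow_zero, mul_one]
    _ ≤ s := mul_le_of_le_one_right (Nat.cast_nonneg s) hbase
end

section
/- There exists an absolute constant c > 0 such that the following holds. Let n, d be integers with 120 ≤ d ≤ (1/150)·(log₂ n / log₂ log₂ n)², let q be a prime with ⌊n/(2d)⌋ ≤ q ≤ ⌊n/d⌋, and let k be an integer with d/30 ≤ k ≤ d/2 − √d/8. Set n_0 := 2(d−k)·(qd/k)^{k/(d−k)} (a real number) and ℓ := ⌊q·d²/n_0⌋. Then over any field F, SP_{k,ℓ}(NW_{q,d,k}) ≥ 2^{−c·d}·M(qd,k)·M(qd,ℓ). -/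
open MvPolynomial

/-- The Nisan–Wigderson design polynomial `NW_{q,d,k}`, where the finite field `F_q` is
represented by a finite field `K` (with `q = Fintype.card K`), the injection of `[d]` into
`F_q` is `ι`, and polynomials `h ∈ F_q[z]` of degree `< k` are parametrized by their
coefficient vectors `c : Fin k → K`. The variables are indexed by `Fin d × K`. -/
noncomputable def NW (K : Type*) [Field K] [Fintype K] (d k : ℕ) (ι : Fin d → K)
    (F : Type*) [Field F] : MvPolynomial (Fin d × K) F :=
  ∑ c : Fin k → K, ∏ i : Fin d, MvPolynomial.X (i, ∑ j : Fin k, c j * ι i ^ (j : ℕ))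

/-- The exponent vector of the product of the variables `x_{i, v i}` over the rows `i ∈ T`. -/
noncomputable def graphExp {R K : Type*} (v : R → K) (T : Finset R) : R × K →₀ ℕ :=
  ∑ i ∈ T, Finsupp.single (i, v i) 1

open Classical in
theorem graphExp_apply {R K : Type*} (v : R → K) (T : Finset R) (p : R × K) :
    graphExp v T p = if p.1 ∈ T ∧ v p.1 = p.2 then 1 else 0 := by
  obtain ⟨i, a⟩ := p
  simp only [graphExp, Finsupp.finsetSum_apply, Finsupp.single_apply, Prod.mk.injEq]
  by_cases hi : i ∈ T
  · rw [Finset.sum_eq_single_of_mem i hi fun b _ hb => if_neg fun h => hb h.1]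
    simp [hi]
  · simp only [hi, false_and, if_false]
    refine Finset.sum_eq_zero fun b hb => if_neg ?_
    rintro ⟨rfl, -⟩
    exact hi hb

theorem graphExp_apply_le_one {R K : Type*} (v : R → K) (T : Finset R) (p : R × K) :
    graphExp v T p ≤ 1 := by
  classical
  rw [graphExp_apply]
  split_ifs <;> simp

theorem graphExp_le_iff {R K : Type*} (v : R → K) (T : Finset R) (w : R × K →₀ ℕ) :
    graphExp v T ≤ w ↔ ∀ i ∈ T, 1 ≤ w (i, v i) := by
  classical
  constructor
  · intro h i hi
    have := h (i, v i)
    rwa [graphExp_apply, if_pos ⟨hi, rfl⟩] at this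
  · rintro h ⟨i, a⟩
    rw [graphExp_apply]
    split_ifs with hia
    · rw [← show v i = a from hia.2]
      exact h i hia.1
    · exact Nat.zero_le _

theorem degree_graphExp {R K : Type*} (v : R → K) (T : Finset R) :
    (graphExp v T).degree = T.card := by
  simp [graphExp, map_sum]

theorem prod_map_pderiv_monomial {σ F : Type*} [CommRing F] (L : List σ) (hL : L.Nodup)
    (s : σ →₀ ℕ) (hs : ∀ i, s i ≤ 1) :
    (L.map fun i => ((pderiv i).toLinearMap : Module.End F (MvPolynomial σ F))).prod
        (monomial s 1) =
      if ∀ i ∈ L, s i = 1 then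
        monomial (s - (L.map fun i => Finsupp.single i 1).sum) 1 else 0 := by
  induction L with
  | nil => simp
  | cons a L ih =>
    obtain ⟨ha, hLn⟩ := List.nodup_cons.1 hL
    have hz : ((L.map fun i => (Finsupp.single i 1 : σ →₀ ℕ)).sum) a = 0 := by
      clear ih hL hLn
      induction L with
      | nil => simp
      | cons b L ih =>
        rw [List.mem_cons, not_or] at ha
        simp [ih ha.2, Finsupp.single_eq_of_ne ha.1]
    rw [List.map_cons, List.prod_cons, Module.End.mul_apply, ih hLn]
    by_cases h : ∀ i ∈ L, s i = 1
    · rw [if_pos h]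
      have hd : (pderiv a).toLinearMap (monomial (s - (L.map fun i => Finsupp.single i 1).sum)
          (1 : F)) = monomial (s - (L.map fun i => Finsupp.single i 1).sum - Finsupp.single a 1)
            ((s a : ℕ) : F) := by
        change pderiv a _ = _
        rw [pderiv_monomial, Finsupp.tsub_apply, hz]
        simp
      rw [hd]
      have := hs a
      by_cases h1 : s a = 1
      · rw [if_pos (by simpa [h1] using h), h1, List.map_cons, List.sum_cons, tsub_tsub,
          add_comm, Nat.cast_one]
      · rw [if_neg (by simp [h1]), show s a = 0 by omega]
        simp
    · rw [if_neg h, if_neg fun h' => h fun i hi => h' i (List.mem_cons_of_mem a hi), map_zero]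

open Classical in
/-- Multilinear derivatives of multilinear monomials. -/
theorem iterDeriv_monomial {σ F : Type*} [CommRing F] (m s : σ →₀ ℕ) (hm : ∀ i, m i ≤ 1)
    (hs : ∀ i, s i ≤ 1) :
    iterDeriv m (monomial s (1 : F)) = if m ≤ s then monomial (s - m) 1 else 0 := by
  have hone : ∀ i ∈ m.support, m i = 1 := fun i hi =>
    le_antisymm (hm i) (Nat.one_le_iff_ne_zero.2 (Finsupp.mem_support_iff.1 hi))
  have hsum : (m.support.toList.map fun i => (Finsupp.single i 1 : σ →₀ ℕ)).sum = m := by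
    rw [Finset.sum_map_toList]
    conv_rhs => rw [← Finsupp.sum_single m, Finsupp.sum]
    exact Finset.sum_congr rfl fun i hi => by rw [hone i hi]
  have hlist : m.support.toList.map
      (fun i => ((pderiv i).toLinearMap : Module.End F (MvPolynomial σ F)) ^ m i) =
      m.support.toList.map fun i => (pderiv i).toLinearMap := by
    refine List.map_congr_left fun i hi => ?_
    rw [hone i (Finset.mem_toList.1 hi), pow_one]
  rw [iterDeriv, hlist, prod_map_pderiv_monomial _ (Finset.nodup_toList _) s hs, hsum]
  refine if_congr ⟨fun h i => ?_, fun h i hi => ?_⟩ rfl rfl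
  · by_cases hi : i ∈ m.support
    · rw [h i (Finset.mem_toList.2 hi)]
      exact hm i
    · rw [Finsupp.notMem_support_iff.1 hi]
      exact Nat.zero_le _
  · have h1 := h i
    rw [hone i (Finset.mem_toList.1 hi)] at h1
    exact le_antisymm (hs i) h1

/-- The values at the points `ι i` of the polynomial with coefficient vector `c`. -/
def polyVal {R K : Type*} [Field K] {k : ℕ} (ι : R → K) (c : Fin k → K) (i : R) : K :=
  ∑ j : Fin k, c j * ι i ^ (j : ℕ)

theorem polyVal_injective {R K : Type*} [Field K] {k : ℕ} {ι : R → K}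
    (hι : Function.Injective ι) {T : Finset R} (hT : k ≤ T.card) {a b : Fin k → K}
    (hab : ∀ i ∈ T, polyVal ι a i = polyVal ι b i) : a = b := by
  obtain ⟨S, hST, hS⟩ := Finset.exists_subset_card_eq hT
  let e := (S.equivFinOfCardEq hS).symm
  have hinj : Function.Injective fun i : Fin k => ι (e i) :=
    hι.comp (Subtype.val_injective.comp e.injective)
  have h := Matrix.eq_zero_of_forall_index_sum_pow_mul_eq_zero (f := fun i => ι (e i))
    (v := a - b) hinj fun i => by
      have := hab (e i) (hST (e i).2)
      simp only [polyVal] at this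
      simp only [Pi.sub_apply, mul_sub, Finset.sum_sub_distrib, sub_eq_zero]
      simpa only [mul_comm] using this
  exact sub_eq_zero.1 h

theorem NW_eq_sum_monomial (K : Type*) [Field K] [Fintype K] (d k : ℕ) (ι : Fin d → K)
    (F : Type*) [Field F] :
    NW K d k ι F = ∑ c : Fin k → K, monomial (graphExp (polyVal ι c) Finset.univ) 1 := by
  refine Finset.sum_congr rfl fun c _ => ?_
  rw [graphExp, monomial_sum_one]
  rfl

theorem iterDeriv_NW {K : Type*} [Field K] [Fintype K] {d k : ℕ} {ι : Fin d → K}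
    (hι : Function.Injective ι) (F : Type*) [Field F] {T : Finset (Fin d)} (hT : k ≤ T.card)
    (a : Fin k → K) :
    iterDeriv (graphExp (polyVal ι a) T) (NW K d k ι F) =
      monomial (graphExp (polyVal ι a) Tᶜ) 1 := by
  classical
  rw [NW_eq_sum_monomial, map_sum, Finset.sum_eq_single_of_mem a (Finset.mem_univ _)]
  · rw [iterDeriv_monomial _ _ (graphExp_apply_le_one _ _) (graphExp_apply_le_one _ _), if_pos]
    · congr 1
      rw [graphExp, graphExp, graphExp, ← Finset.sum_add_sum_compl T, add_tsub_cancel_left]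
    · exact (graphExp_le_iff _ _ _).2 fun i _ => by rw [graphExp_apply]; simp
  · intro b _ hb
    rw [iterDeriv_monomial _ _ (graphExp_apply_le_one _ _) (graphExp_apply_le_one _ _), if_neg]
    rw [graphExp_le_iff]
    intro h
    refine hb (polyVal_injective hι hT fun i hi => ?_)
    have := h i hi
    rw [graphExp_apply] at this
    by_contra hne
    simp [hne] at this

/-- The exponent vectors of the monomials of degree `ℓ`. -/
noncomputable def monomialsOfDegree (σ : Type*) [Fintype σ] (ℓ : ℕ) : Finset (σ →₀ ℕ) :=
  open Classical in Finset.finsuppAntidiag Finset.univ ℓ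

theorem mem_monomialsOfDegree {σ : Type*} [Fintype σ] {ℓ : ℕ} {m : σ →₀ ℕ} :
    m ∈ monomialsOfDegree σ ℓ ↔ m.degree = ℓ := by
  simp [monomialsOfDegree, Finsupp.degree_eq_sum]

theorem card_monomialsOfDegree (σ : Type*) [Fintype σ] (ℓ : ℕ) :
    (monomialsOfDegree σ ℓ).card = M (Fintype.card σ) ℓ := by
  classical
  rw [monomialsOfDegree, Finset.card_finsuppAntidiag_nat_eq_choose, M, Finset.card_univ]

theorem finite_shiftedPartialsSet {σ F : Type*} [Fintype σ] [Field F] (ℓ k : ℕ)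
    (P : MvPolynomial σ F) : (shiftedPartialsSet ℓ k P).Finite := by
  refine (Set.Finite.image2 (fun m m' => monomial m (1 : F) * iterDeriv m' P)
    (monomialsOfDegree σ ℓ).finite_toSet (monomialsOfDegree σ k).finite_toSet).subset ?_
  rintro _ ⟨m, hm, _, ⟨m', hm', rfl⟩, rfl⟩
  exact ⟨m, mem_monomialsOfDegree.2 hm, m', mem_monomialsOfDegree.2 hm', rfl⟩

/-- If `U` is a set of monomials, each of which is a shifted partial derivative of `P`, then the
shifted partials measure of `P` is at least the size of `U`. -/
theorem card_le_SP {σ F : Type*} [Fintype σ] [Field F] {k ℓ : ℕ} {P : MvPolynomial σ F}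
    (U : Finset (σ →₀ ℕ)) (hU : ∀ w ∈ U, monomial w (1 : F) ∈ shiftedPartialsSet ℓ k P) :
    U.card ≤ SP k ℓ P := by
  have := FiniteDimensional.span_of_finite F (finite_shiftedPartialsSet ℓ k P)
  have hli : LinearIndependent F fun w : U => monomial (w : σ →₀ ℕ) (1 : F) := by
    have h := (basisMonomials σ F).linearIndependent
    rw [coe_basisMonomials] at h
    exact h.comp _ Subtype.val_injective
  rw [← Fintype.card_coe U, ← finrank_span_eq_card hli]
  refine Submodule.finrank_mono (Submodule.span_mono ?_)
  rintro _ ⟨w, rfl⟩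
  exact hU w w.2

theorem M_mul_le {N : ℕ} (hN : 1 ≤ N) (j : ℕ) : M N j * N ≤ M N (j + 1) * (j + 1) := by
  obtain ⟨N, rfl⟩ := Nat.exists_eq_add_of_le' hN
  have h := Nat.add_one_mul_choose_eq (N + j) j
  rw [M, M, show N + 1 + j - 1 = N + j by omega, show N + 1 + (j + 1) - 1 = N + j + 1 by omega,
    ← h, mul_comm]
  exact Nat.mul_le_mul_right _ (by omega)

theorem M_sub_mul_pow_le {N : ℕ} (hN : 1 ≤ N) {t ℓ : ℕ} (ht : t ≤ ℓ) :
    M N (ℓ - t) * N ^ t ≤ M N ℓ * ℓ ^ t := by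
  induction t with
  | zero => simp
  | succ t ih =>
    calc M N (ℓ - (t + 1)) * N ^ (t + 1) = M N (ℓ - (t + 1)) * N * N ^ t := by ring
      _ ≤ M N (ℓ - t) * (ℓ - t) * N ^ t := by
        have h := M_mul_le hN (ℓ - (t + 1))
        rw [show ℓ - (t + 1) + 1 = ℓ - t by omega] at h
        exact Nat.mul_le_mul_right _ h
      _ ≤ M N (ℓ - t) * ℓ * N ^ t := by gcongr; omega
      _ = M N (ℓ - t) * N ^ t * ℓ := by ring
      _ ≤ M N ℓ * ℓ ^ t * ℓ := Nat.mul_le_mul_right _ (ih (by omega))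
      _ = M N ℓ * ℓ ^ (t + 1) := by ring

open Classical in
/-- The number of multiples of degree `ℓ` of a monomial of degree `t`. -/
theorem card_multiples_mul_pow_le {σ : Type*} [Fintype σ] [Nonempty σ] (ℓ : ℕ) (u : σ →₀ ℕ) :
    ((monomialsOfDegree σ ℓ).filter (u ≤ ·)).card * Fintype.card σ ^ u.degree ≤
      M (Fintype.card σ) ℓ * ℓ ^ u.degree := by
  by_cases ht : u.degree ≤ ℓ
  · refine le_trans (Nat.mul_le_mul_right _ ?_) (M_sub_mul_pow_le Fintype.card_pos ht)
    rw [← card_monomialsOfDegree]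
    refine Finset.card_le_card_of_injOn (· - u) (fun m hm => ?_) (fun m hm m' hm' h => ?_)
    · obtain ⟨hm, hu⟩ := Finset.mem_filter.1 hm
      rw [mem_monomialsOfDegree] at hm
      refine mem_monomialsOfDegree.2 ?_
      have h := congrArg Finsupp.degree (tsub_add_cancel_of_le hu)
      rw [map_add, hm] at h
      exact Nat.eq_sub_of_add_eq h
    · exact tsub_left_inj (Finset.mem_filter.1 hm).2 (Finset.mem_filter.1 hm').2 |>.1 h
  · rw [Finset.filter_eq_empty_iff.2]
    · simp
    · intro m hm hu
      rw [mem_monomialsOfDegree] at hm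
      have h := congrArg Finsupp.degree (tsub_add_cancel_of_le hu)
      rw [map_add, hm] at h
      omega

/-- The degree-`ℓ` multiples of the monomial `∏ i ∈ T, x_{i, v i}`. -/
noncomputable def graphShifts {R K : Type*} [Fintype R] [Fintype K] (ℓ : ℕ) (T : Finset R)
    (v : R → K) : Finset (R × K →₀ ℕ) :=
  (monomialsOfDegree (R × K) ℓ).map (addLeftEmbedding (graphExp v T))

theorem card_graphShifts {R K : Type*} [Fintype R] [Fintype K] (ℓ : ℕ) (T : Finset R)
    (v : R → K) : (graphShifts ℓ T v).card = M (Fintype.card (R × K)) ℓ := by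
  rw [graphShifts, Finset.card_map, card_monomialsOfDegree]

open Classical in
theorem card_graphShifts_inter_le {R K : Type*} [Fintype R] [Fintype K] (ℓ : ℕ) (T : Finset R)
    (v v' : R → K) :
    (graphShifts ℓ T v ∩ graphShifts ℓ T v').card ≤
      ((monomialsOfDegree (R × K) ℓ).filter
        (graphExp v' (T.filter fun i => v i ≠ v' i) ≤ ·)).card := by
  refine Finset.card_le_card_of_injOn (· - graphExp v T) (fun w hw => ?_)
    (fun w hw w' hw' h => ?_)
  · obtain ⟨h₁, h₂⟩ := Finset.mem_inter.1 hw
    obtain ⟨m, hm, rfl⟩ := Finset.mem_map.1 h₁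
    obtain ⟨m', -, hm'⟩ := Finset.mem_map.1 h₂
    simp only [addLeftEmbedding_apply, add_tsub_cancel_left, SetLike.mem_coe] at hm' ⊢
    refine Finset.mem_filter.2 ⟨hm, (graphExp_le_iff _ _ _).2 fun i hi => ?_⟩
    obtain ⟨hi, hne⟩ := Finset.mem_filter.1 hi
    have h := DFunLike.congr_fun hm' (i, v' i)
    simp only [Finsupp.add_apply, graphExp_apply, hi, hne, and_true, and_false, if_true,
      if_false] at h
    omega
  · obtain ⟨m, -, rfl⟩ := Finset.mem_map.1 (Finset.mem_inter.1 hw).1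
    obtain ⟨m', -, rfl⟩ := Finset.mem_map.1 (Finset.mem_inter.1 hw').1
    simpa using h

open Classical in
theorem card_graphShifts_inter_le_pow {R K : Type*} [Fintype R] [Fintype K] [Nonempty R]
    [Nonempty K] {ℓ : ℕ} {ρ : ℝ} (hρ : (ℓ : ℝ) ≤ ρ * Fintype.card (R × K)) (T : Finset R)
    (v v' : R → K) :
    ((graphShifts ℓ T v ∩ graphShifts ℓ T v').card : ℝ) ≤
      M (Fintype.card (R × K)) ℓ * ρ ^ (T.filter fun i => v i ≠ v' i).card := by
  have hN : (0 : ℝ) < Fintype.card (R × K) := by exact_mod_cast Fintype.card_pos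
  set N := Fintype.card (R × K)
  set t := (T.filter fun i => v i ≠ v' i).card
  have h₁ : (graphShifts ℓ T v ∩ graphShifts ℓ T v').card * N ^ t ≤ M N ℓ * ℓ ^ t := by
    have h := card_multiples_mul_pow_le ℓ (graphExp v' (T.filter fun i => v i ≠ v' i))
    rw [degree_graphExp] at h
    exact (Nat.mul_le_mul_right _ (card_graphShifts_inter_le ℓ T v v')).trans h
  have h₂ : ((graphShifts ℓ T v ∩ graphShifts ℓ T v').card : ℝ) * (N : ℝ) ^ t ≤
      M N ℓ * (ℓ : ℝ) ^ t := by exact_mod_cast h₁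
  refine le_of_mul_le_mul_right (h₂.trans ?_) (pow_pos hN t)
  rw [mul_assoc, ← mul_pow]
  gcongr

open Classical in
theorem card_polyVal_eq_on_le {R K : Type*} [Fintype R] [Field K] [Fintype K] {k : ℕ}
    {ι : R → K} (hι : Function.Injective ι) (hk : k ≤ Fintype.card R) {S : Finset R}
    (hS : S.card ≤ k) (a : Fin k → K) :
    (Finset.univ.filter fun b : Fin k → K => ∀ i ∈ S, polyVal ι a i = polyVal ι b i).card ≤
      Fintype.card K ^ (k - S.card) := by
  obtain ⟨S', hSS', -, hS'⟩ := Finset.exists_subsuperset_card_eq (Finset.subset_univ S) hS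
    (by rwa [Finset.card_univ])
  have hcard : Fintype.card (↥(S' \ S) → K) = Fintype.card K ^ (k - S.card) := by
    rw [Fintype.card_fun, Fintype.card_coe, Finset.card_sdiff_of_subset hSS', hS']
  rw [← hcard, ← Finset.card_univ]
  refine Finset.card_le_card_of_injOn (fun b (i : ↥(S' \ S)) => polyVal ι b i)
    (fun _ _ => Finset.mem_coe.2 (Finset.mem_univ _)) (fun b hb b' hb' h => ?_)
  refine polyVal_injective hι hS'.ge fun i hi => ?_
  by_cases hiS : i ∈ S
  · rw [← (Finset.mem_filter.1 hb).2 i hiS, (Finset.mem_filter.1 hb').2 i hiS]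
  · exact congrFun h ⟨i, Finset.mem_sdiff.2 ⟨hi, hiS⟩⟩

theorem pow_sub_mul_pow_sub_le {q ρ C : ℝ} {k D j : ℕ} (hq : 0 < q) (hρ : 0 < ρ) (hC : 1 ≤ C)
    (hqρ : 1 ≤ C * (q * ρ)) (hkD : q ^ k * ρ ^ D ≤ 1) (hjk : j ≤ k) (hjD : j ≤ D) :
    q ^ (k - j) * ρ ^ (D - j) ≤ C ^ D := by
  have hx : 0 < q ^ (k - j) * ρ ^ (D - j) := by positivity
  calc q ^ (k - j) * ρ ^ (D - j)
      ≤ q ^ (k - j) * ρ ^ (D - j) * (C * (q * ρ)) ^ j :=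
        le_mul_of_one_le_right hx.le (one_le_pow₀ hqρ)
    _ = q ^ (k - j + j) * ρ ^ (D - j + j) * C ^ j := by ring
    _ = q ^ k * ρ ^ D * C ^ j := by rw [Nat.sub_add_cancel hjk, Nat.sub_add_cancel hjD]
    _ ≤ 1 * C ^ j := by gcongr
    _ ≤ C ^ D := by rw [one_mul]; exact pow_le_pow_right₀ hC hjD

open Classical in
theorem sum_pow_card_polyVal_ne_le {R K : Type*} [Fintype R] [Field K] [Fintype K] {k : ℕ}
    {ι : R → K} (hι : Function.Injective ι) {T : Finset R} (hk : k ≤ T.card) {ρ C : ℝ}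
    (hρ : 0 < ρ) (hC : 1 ≤ C) (hqρ : 1 ≤ C * (Fintype.card K * ρ))
    (hkT : (Fintype.card K : ℝ) ^ k * ρ ^ T.card ≤ 1) (a : Fin k → K) :
    ∑ b : Fin k → K, ρ ^ (T.filter fun i => polyVal ι a i ≠ polyVal ι b i).card ≤
      1 + (2 * C) ^ T.card := by
  have hq : (0 : ℝ) < Fintype.card K := by exact_mod_cast Fintype.card_pos
  set 𝒮 := T.powerset.filter fun S => S.card ≤ k
  have hterm : ∀ b ∈ Finset.univ.erase a,
      ρ ^ (T.filter fun i => polyVal ι a i ≠ polyVal ι b i).card ≤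
        ∑ S ∈ 𝒮, if ∀ i ∈ S, polyVal ι a i = polyVal ι b i then ρ ^ (T.card - S.card) else 0 := by
    intro b hb
    set S := T.filter fun i => polyVal ι a i = polyVal ι b i
    have hagree : ∀ i ∈ S, polyVal ι a i = polyVal ι b i := fun i hi => (Finset.mem_filter.1 hi).2
    have hS : S ∈ 𝒮 := by
      refine Finset.mem_filter.2 ⟨Finset.mem_powerset.2 (Finset.filter_subset _ _), ?_⟩
      by_contra! hlt
      exact Finset.ne_of_mem_erase hb (polyVal_injective hι hlt.le hagree).symm
    have hcard : (T.filter fun i => polyVal ι a i ≠ polyVal ι b i).card = T.card - S.card := by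
      have := Finset.card_filter_add_card_filter_not (s := T) fun i => polyVal ι a i = polyVal ι b i
      exact Nat.eq_sub_of_add_eq' this
    rw [hcard]
    refine le_trans (le_of_eq ?_) (Finset.single_le_sum (fun S _ => ?_) hS)
    · rw [if_pos hagree]
    · split_ifs <;> positivity
  have hS : ∀ S ∈ 𝒮, ∑ b ∈ Finset.univ.erase a,
      (if ∀ i ∈ S, polyVal ι a i = polyVal ι b i then ρ ^ (T.card - S.card) else 0) ≤
        C ^ T.card := by
    intro S hS
    obtain ⟨hST, hSk⟩ := Finset.mem_filter.1 hS
    have hST := Finset.card_le_card (Finset.mem_powerset.1 hST)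
    refine le_trans ?_ (pow_sub_mul_pow_sub_le hq hρ hC hqρ hkT hSk hST)
    refine (Finset.sum_le_sum_of_subset_of_nonneg (Finset.subset_univ _) fun b _ _ => ?_).trans ?_
    · split_ifs <;> positivity
    · rw [← Finset.sum_filter, Finset.sum_const, nsmul_eq_mul]
      gcongr
      exact_mod_cast card_polyVal_eq_on_le hι (hk.trans (Finset.card_le_univ _)) hSk a
  rw [← Finset.add_sum_erase _ _ (Finset.mem_univ a)]
  refine add_le_add (by simp) ((Finset.sum_le_sum hterm).trans ?_)
  rw [Finset.sum_comm]
  refine (Finset.sum_le_card_nsmul _ _ _ hS).trans ?_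
  rw [nsmul_eq_mul, mul_pow]
  gcongr
  exact_mod_cast (Finset.card_filter_le _ _).trans (Finset.card_powerset T).le

/-- The second moment lower bound for the size of a union. -/
theorem sq_sum_card_le_card_biUnion_mul {α β : Type*} [Fintype α] [DecidableEq β]
    (A : α → Finset β) :
    (∑ a, (A a).card) ^ 2 ≤ (Finset.univ.biUnion A).card * ∑ a, ∑ b, (A a ∩ A b).card := by
  set U := Finset.univ.biUnion A
  have hAU : ∀ a, A a ⊆ U := fun a => Finset.subset_biUnion_of_mem A (Finset.mem_univ a)
  have hcard : ∀ s ⊆ U, s.card = ∑ w ∈ U, if w ∈ s then 1 else 0 := by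
    intro s hs
    rw [Finset.sum_ite_mem, Finset.inter_eq_right.2 hs, Finset.card_eq_sum_ones]
  have h₁ : ∑ a, (A a).card = ∑ w ∈ U, ∑ a, if w ∈ A a then 1 else 0 := by
    rw [Finset.sum_comm]
    exact Finset.sum_congr rfl fun a _ => hcard _ (hAU a)
  have h₂ : ∑ a, ∑ b, (A a ∩ A b).card = ∑ w ∈ U, (∑ a, if w ∈ A a then 1 else 0) ^ 2 := by
    simp_rw [sq, Finset.sum_mul_sum]
    symm
    rw [Finset.sum_comm]
    refine Finset.sum_congr rfl fun a _ => ?_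
    rw [Finset.sum_comm]
    refine Finset.sum_congr rfl fun b _ => ?_
    rw [hcard _ (Finset.inter_subset_left.trans (hAU a))]
    refine Finset.sum_congr rfl fun w _ => ?_
    by_cases ha : w ∈ A a <;> by_cases hb : w ∈ A b <;> simp [ha, hb]
  rw [h₁, h₂]
  exact sq_sum_le_card_mul_sum_sq

theorem exists_finset_graphShifts_card_ge {R K : Type*} [Fintype R] [Field K] [Fintype K] [Nonempty R]
    {k ℓ : ℕ} {ι : R → K} (hι : Function.Injective ι) {T : Finset R} (hk : k ≤ T.card)
    {ρ C : ℝ} (hρ : 0 < ρ) (hC : 1 ≤ C) (hqρ : 1 ≤ C * (Fintype.card K * ρ))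
    (hkT : (Fintype.card K : ℝ) ^ k * ρ ^ T.card ≤ 1)
    (hℓ : (ℓ : ℝ) ≤ ρ * Fintype.card (R × K)) :
    ∃ U : Finset (R × K →₀ ℕ),
      (∀ w ∈ U, ∃ a : Fin k → K, w ∈ graphShifts ℓ T (polyVal ι a)) ∧
      (Fintype.card K : ℝ) ^ k * M (Fintype.card (R × K)) ℓ ≤
        U.card * (1 + (2 * C) ^ T.card) := by
  classical
  set U := Finset.univ.biUnion fun a : Fin k → K => graphShifts ℓ T (polyVal ι a)
  have hq : (0 : ℝ) < Fintype.card K := by exact_mod_cast Fintype.card_pos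
  have hM : (0 : ℝ) < M (Fintype.card (R × K)) ℓ := by
    have : 0 < Fintype.card (R × K) := Fintype.card_pos
    exact Nat.cast_pos.2 (Nat.choose_pos (by omega))
  have hsum : ∑ a : Fin k → K, (graphShifts ℓ T (polyVal ι a)).card =
      Fintype.card K ^ k * M (Fintype.card (R × K)) ℓ := by
    simp [card_graphShifts]
  have h := sq_sum_card_le_card_biUnion_mul fun a : Fin k → K => graphShifts ℓ T (polyVal ι a)
  rw [hsum] at h
  set x := (Fintype.card K : ℝ) ^ k * M (Fintype.card (R × K)) ℓ with hx
  have hx0 : 0 < x := by positivity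
  have h' : x ^ 2 ≤ U.card * ∑ a : Fin k → K, ∑ b : Fin k → K,
      ((graphShifts ℓ T (polyVal ι a) ∩ graphShifts ℓ T (polyVal ι b)).card : ℝ) := by
    have := (Nat.cast_le (α := ℝ)).2 h
    push_cast at this
    exact this
  have hinter : ∑ a : Fin k → K, ∑ b : Fin k → K,
      ((graphShifts ℓ T (polyVal ι a) ∩ graphShifts ℓ T (polyVal ι b)).card : ℝ) ≤
        x * (1 + (2 * C) ^ T.card) := by
    have hrow : ∀ a ∈ (Finset.univ : Finset (Fin k → K)), ∑ b : Fin k → K,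
        ((graphShifts ℓ T (polyVal ι a) ∩ graphShifts ℓ T (polyVal ι b)).card : ℝ) ≤
          M (Fintype.card (R × K)) ℓ * (1 + (2 * C) ^ T.card) := by
      intro a _
      refine (Finset.sum_le_sum fun b _ => card_graphShifts_inter_le_pow hℓ T _ _).trans ?_
      rw [← Finset.mul_sum]
      gcongr
      exact sum_pow_card_polyVal_ne_le hι hk hρ hC hqρ hkT a
    refine (Finset.sum_le_card_nsmul _ _ _ hrow).trans (le_of_eq ?_)
    simp [hx, mul_assoc]
  refine ⟨U, fun w hw => ?_, le_of_mul_le_mul_left ?_ hx0⟩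
  · obtain ⟨a, -, ha⟩ := Finset.mem_biUnion.1 hw
    exact ⟨a, ha⟩
  calc x * x = x ^ 2 := (sq x).symm
    _ ≤ U.card * (x * (1 + (2 * C) ^ T.card)) := h'.trans (by gcongr)
    _ = x * (U.card * (1 + (2 * C) ^ T.card)) := by ring

theorem monomial_mem_shiftedPartialsSet_NW {K : Type*} [Field K] [Fintype K] {d k ℓ : ℕ}
    {ι : Fin d → K} (hι : Function.Injective ι) (F : Type*) [Field F] {T : Finset (Fin d)}
    (hT : T.card = k) (a : Fin k → K) {w : Fin d × K →₀ ℕ}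
    (hw : w ∈ graphShifts ℓ Tᶜ (polyVal ι a)) :
    monomial w (1 : F) ∈ shiftedPartialsSet ℓ k (NW K d k ι F) := by
  obtain ⟨m, hm, rfl⟩ := Finset.mem_map.1 hw
  refine ⟨m, mem_monomialsOfDegree.1 hm, _,
    ⟨graphExp (polyVal ι a) T, (degree_graphExp _ _).trans hT, rfl⟩, ?_⟩
  rw [iterDeriv_NW hι F hT.ge, monomial_mul, one_mul, addLeftEmbedding_apply, add_comm]

theorem M_le_mul_pow {q d k : ℕ} (hq : 1 ≤ q) (hk : 0 < k) (hkd : k ≤ d)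
    (hdk : (d : ℝ) ≤ 30 * k) : (M (q * d) k : ℝ) ≤ 180 ^ k * (q : ℝ) ^ k := by
  have hfac : (0 : ℝ) < k.factorial := by exact_mod_cast k.factorial_pos
  have hexp : (k : ℝ) ^ k ≤ 3 ^ k * k.factorial := by
    have h := Real.pow_div_factorial_le_exp (k : ℝ) (Nat.cast_nonneg k) k
    rw [div_le_iff₀ hfac, ← Real.exp_one_pow] at h
    refine h.trans ?_
    gcongr
    exact (Real.exp_one_lt_d9.trans (by norm_num)).le
  have hle : ((q * d + k - 1 : ℕ) : ℝ) ≤ 60 * q * k := by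
    have h₁ : q * d + k - 1 ≤ 2 * (q * d) := by
      have : d ≤ q * d := Nat.le_mul_of_pos_left d hq
      omega
    calc ((q * d + k - 1 : ℕ) : ℝ) ≤ ((2 * (q * d) : ℕ) : ℝ) := by exact_mod_cast h₁
      _ = 2 * q * d := by push_cast; ring
      _ ≤ 2 * q * (30 * k) := by gcongr
      _ = 60 * q * k := by ring
  calc (M (q * d) k : ℝ) ≤ ((q * d + k - 1 : ℕ) : ℝ) ^ k / k.factorial :=
        Nat.choose_le_pow_div k _
    _ ≤ (60 * q * k) ^ k / k.factorial := by gcongr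
    _ = (60 * q) ^ k * (k : ℝ) ^ k / k.factorial := by rw [mul_pow]
    _ ≤ (60 * q) ^ k * (3 ^ k * k.factorial) / k.factorial := by gcongr
    _ = 180 ^ k * (q : ℝ) ^ k := by
      rw [← mul_assoc, mul_div_cancel_right₀ _ hfac.ne', ← mul_pow, ← mul_pow]
      ring

/-- `NW` as a hard polynomial for shifted partials. -/
theorem stmt9 : ∃ c : ℝ, 0 < c ∧
    ∀ (n d q k : ℕ) (K : Type*) [Field K] [Fintype K], Fintype.card K = q → Nat.Prime q →
    ∀ ι : Fin d → K, Function.Injective ι →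
    120 ≤ d →
    (d : ℝ) ≤ (1 / 150) * (Real.logb 2 (n : ℝ) / Real.logb 2 (Real.logb 2 (n : ℝ))) ^ 2 →
    n / (2 * d) ≤ q → q ≤ n / d →
    (d : ℝ) / 30 ≤ (k : ℝ) → (k : ℝ) ≤ (d : ℝ) / 2 - Real.sqrt (d : ℝ) / 8 →
    ∀ n0 : ℝ,
      n0 = 2 * ((d : ℝ) - (k : ℝ)) *
        (((q * d : ℕ) : ℝ) / (k : ℝ)) ^ ((k : ℝ) / ((d : ℝ) - (k : ℝ))) →
    ∀ ℓ : ℕ, ℓ = ⌊(q : ℝ) * (d : ℝ) ^ 2 / n0⌋₊ →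
    ∀ (F : Type*) [Field F],
      (2 : ℝ) ^ (-(c * (d : ℝ))) * (M (q * d) k : ℝ) * (M (q * d) ℓ : ℝ) ≤
        (SP k ℓ (NW K d k ι F) : ℝ) := by
  refine ⟨14, by norm_num, ?_⟩
  intro n d q k K _ _ hq hqp ι hι hd _ _ _ hdk hkd n0 hn0 ℓ hℓ F _
  classical
  have hq0 : (0 : ℝ) < q := by exact_mod_cast hqp.pos
  have hd0 : (0 : ℝ) < d := by exact_mod_cast (by omega : 0 < d)
  have hk0 : (0 : ℝ) < k := by linarith
  have h2k : 2 * (k : ℝ) ≤ d := by linarith [Real.sqrt_nonneg (d : ℝ)]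
  have h2k' : 2 * k ≤ d := by exact_mod_cast h2k
  have hD0 : (0 : ℝ) < d - k := by linarith
  set x : ℝ := k / (q * d) with hx
  set e : ℝ := k / (d - k) with he
  set ρ : ℝ := x ^ e with hρ
  have hx0 : 0 < x := by positivity
  have hqx : q * x = k / d := by rw [hx]; field_simp
  have hx1 : x ≤ 1 := by
    rw [hx, div_le_one (by positivity)]
    have : (1 : ℝ) ≤ q := by exact_mod_cast hqp.one_le
    nlinarith
  have hρ0 : 0 < ρ := Real.rpow_pos_of_pos hx0 e
  have hqρ : 1 ≤ 30 * (q * ρ) := by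
    have hxρ : x ≤ ρ := by
      have h := Real.rpow_le_rpow_of_exponent_ge hx0 hx1
        ((div_le_one hD0).2 (by linarith) : e ≤ 1)
      rwa [Real.rpow_one] at h
    have h : 1 ≤ 30 * (q * x) := by
      rw [hqx, ← mul_div_assoc, le_div_iff₀ hd0]
      linarith
    exact h.trans (by gcongr)
  have hρD : (q : ℝ) ^ k * ρ ^ (d - k) ≤ 1 := by
    have h : ρ ^ (d - k) = x ^ k := by
      rw [hρ, ← Real.rpow_mul_natCast hx0.le, Nat.cast_sub (by omega), he,
        div_mul_cancel₀ _ hD0.ne', Real.rpow_natCast]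
    rw [h, ← mul_pow, hqx]
    exact pow_le_one₀ (by positivity) ((div_le_one hd0).2 (by linarith))
  have hℓρ : (ℓ : ℝ) ≤ ρ * (d * q) := by
    have hn0' : n0 = 2 * (d - k) * ρ⁻¹ := by
      rw [hn0, hρ, ← Real.inv_rpow hx0.le, hx, inv_div]
      push_cast
      rfl
    have hn0pos : 0 < n0 := by rw [hn0']; positivity
    rw [hℓ]
    refine (Nat.floor_le (by positivity)).trans ?_
    rw [div_le_iff₀ hn0pos, hn0']
    calc (q : ℝ) * d ^ 2 = d * q * d := by ring
      _ ≤ d * q * (2 * (d - k)) := by gcongr; linarith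
      _ = ρ * (d * q) * (2 * (d - k) * ρ⁻¹) := by field_simp
  obtain ⟨T, -, hT⟩ := Finset.exists_subset_card_eq
    (show k ≤ (Finset.univ : Finset (Fin d)).card by simp; omega)
  have hTc : Tᶜ.card = d - k := by rw [Finset.card_compl, hT, Fintype.card_fin]
  have hcard : Fintype.card (Fin d × K) = q * d := by
    rw [Fintype.card_prod, Fintype.card_fin, hq, mul_comm]
  have : Nonempty (Fin d) := ⟨⟨0, by omega⟩⟩
  obtain ⟨U, hUmem, hU⟩ := exists_finset_graphShifts_card_ge (T := Tᶜ) (k := k) (ℓ := ℓ) hι (by omega) hρ0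
    (by norm_num : (1 : ℝ) ≤ 30) (by rwa [hq]) (by rwa [hq, hTc])
    (by rw [hcard]; push_cast; rwa [mul_comm (q : ℝ)])
  rw [hq, hcard, hTc] at hU
  have hSP := card_le_SP (P := NW K d k ι F) (k := k) (ℓ := ℓ) U fun w hw => by
      obtain ⟨a, ha⟩ := hUmem w hw
      exact monomial_mem_shiftedPartialsSet_NW hι F hT a ha
  have hMk := M_le_mul_pow (d := d) hqp.one_le (by exact_mod_cast hk0 : 0 < k) (by omega)
    (by linarith)
  have hconst : (180 : ℝ) ^ k * (1 + (2 * 30) ^ (d - k)) ≤ 2 ^ (14 * (d : ℝ)) := by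
    have h₁ : (1 : ℝ) + (2 * 30) ^ (d - k) ≤ 61 ^ d := by
      have h : (60 : ℝ) ^ (d - k) ≤ 60 ^ d := pow_le_pow_right₀ (by norm_num) (by omega)
      have h' : (1 : ℝ) ^ d + 60 ^ d ≤ (1 + 60) ^ d :=
        pow_add_pow_le (by norm_num) (by norm_num) (by omega)
      norm_num at h h' ⊢
      linarith
    calc (180 : ℝ) ^ k * (1 + (2 * 30) ^ (d - k)) ≤ 180 ^ d * 61 ^ d := by
          gcongr
          · norm_num
          · omega
      _ = (180 * 61) ^ d := (mul_pow _ _ _).symm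
      _ ≤ (2 ^ 14) ^ d := by gcongr; norm_num
      _ = 2 ^ (14 * (d : ℝ)) := by
        rw [← pow_mul, ← Real.rpow_natCast]
        push_cast
        rfl
  have hpow : (0 : ℝ) < 2 ^ (14 * (d : ℝ)) := by positivity
  rw [Real.rpow_neg (by norm_num), mul_assoc, inv_mul_le_iff₀ hpow]
  calc (M (q * d) k : ℝ) * M (q * d) ℓ ≤ 180 ^ k * (q : ℝ) ^ k * M (q * d) ℓ := by gcongr
    _ = 180 ^ k * ((q : ℝ) ^ k * M (q * d) ℓ) := by ring
    _ ≤ 180 ^ k * (SP k ℓ (NW K d k ι F) * (1 + (2 * 30) ^ (d - k))) := by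
      refine mul_le_mul_of_nonneg_left (hU.trans ?_) (by positivity)
      gcongr
    _ = 180 ^ k * (1 + (2 * 30) ^ (d - k)) * SP k ℓ (NW K d k ι F) := by ring
    _ ≤ 2 ^ (14 * (d : ℝ)) * SP k ℓ (NW K d k ι F) := by gcongr
end
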